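/- arXiv:1808.09366 — 2 statements merged into one kernel-verified Lean document; each statement's English description precedes it below -/
import Mathlib

section
/- Let A'₀ be the set of pairs (θ,λ), where λ runs over a set of representatives of the G×U orbits in J* (orbits {gλu : g ∈ G, u ∈ U}) and θ runs over the S_{GλU}-irreducible characters of H_{GλU}, and let A' be the quotient of A'₀ by the conjugation action of L. For (θ,λ) ∈ A'₀ let χ'_{θ,λ} be the character induced to G from the character Σ_{p∈L} ξ_{θ,pλ} of the subgroup H_{GλU} ⋉ U_{λ,rt}, where ξ_{θ,pλ}(h(1+x)) = θ(h)·ε^{(pλ)(x)}. Then the characters χ'_α for α representing distinct elements of A' are pairwise orthogonal: ⟨χ'_α, χ'_{α'}⟩ = 0 whenever α and α' lie in different L-conjugation classes of A'₀. -/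
open scoped Classical

section Characters

open Matrix ComplexOrder in
/-- The value of a complex character of a finite group at `g⁻¹` is the complex conjugate of its
value at `g`: conjugating by an averaged positive definite form makes the representation unitary. -/
theorem FDRep.character_inv_eq_conj {H : Type} [Group H] [Finite H] (W : FDRep ℂ H) (g : H) :
    W.character g⁻¹ = (starRingEnd ℂ) (W.character g) := by
  have := Fintype.ofFinite H
  let b := Module.finBasis ℂ W
  let A : H →* Matrix _ _ ℂ := (LinearMap.toMatrixAlgEquiv b).toAlgHom.toMonoidHom.comp W.ρ
  have htr : ∀ h, W.character h = (A h).trace := fun h =>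
    LinearMap.trace_eq_matrix_trace ℂ b (W.ρ h)
  let P := ∑ h : H, (A h)ᴴ * A h
  have hP : P.PosDef := by
    have h1 : P = 1 + ∑ h ∈ Finset.univ.erase (1 : H), (A h)ᴴ * A h := by
      simp only [P]
      rw [← Finset.add_sum_erase _ _ (Finset.mem_univ (1 : H))]
      simp
    rw [h1]
    exact PosDef.one.add_posSemidef
      (posSemidef_sum _ fun h _ => posSemidef_conjTranspose_mul_self (A h))
  have hinv : (A g)ᴴ * P = P * A g⁻¹ := by
    have h2 : (A g)ᴴ * P * A g = P := by
      simp only [P, Finset.mul_sum, Finset.sum_mul]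
      refine Fintype.sum_equiv (Equiv.mulRight g) _ _ fun h => ?_
      simp [map_mul, conjTranspose_mul, Matrix.mul_assoc]
    calc (A g)ᴴ * P = (A g)ᴴ * P * (A g * A g⁻¹) := by rw [← map_mul]; simp
      _ = P * A g⁻¹ := by rw [← Matrix.mul_assoc, h2]
  have hu : IsUnit P.det := P.isUnit_iff_isUnit_det.mp hP.isUnit
  have h3 : A g⁻¹ = P⁻¹ * ((A g)ᴴ * P) := by
    rw [hinv, Matrix.nonsing_inv_mul_cancel_left _ _ hu]
  rw [htr, htr, h3, Matrix.trace_mul_comm, Matrix.mul_assoc, Matrix.mul_nonsing_inv _ hu,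
    Matrix.mul_one, Matrix.trace_conjTranspose]
  rfl

variable {L : Type} [Group L]

/-- `ψ` is an irreducible character of the subgroup with carrier `H`, extended by zero to `L`. -/
def IsIrrCharOn (H : Set L) (ψ : L → ℂ) : Prop :=
  (∀ h : L, h ∉ H → ψ h = 0) ∧
  ∃ H₀ : Subgroup L, (H₀ : Set L) = H ∧
    ∃ W : FDRep ℂ ↥H₀, CategoryTheory.Simple W ∧
      ∀ h : ↥H₀, ψ ↑h = W.character h

/-- `θ` is the sum of an orbit of `S` on the irreducible characters of `H`. -/
def IsOrbitCharOn (H S : Set L) (θ : L → ℂ) : Prop :=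
  ∃ Sfin : Finset (L → ℂ),
    (∀ ψ ∈ Sfin, IsIrrCharOn H ψ) ∧
    (∃ ψ₀ ∈ Sfin, ∀ ψ : L → ℂ,
      ψ ∈ Sfin ↔ ∃ r ∈ S, ∀ h : L, ψ h = ψ₀ (r * h * r⁻¹)) ∧
    ∀ h : L, θ h = ∑ ψ ∈ Sfin, ψ h

theorem IsOrbitCharOn.apply_eq_zero {H S : Set L} {θ : L → ℂ} (hθ : IsOrbitCharOn H S θ)
    {h : L} (hh : h ∉ H) : θ h = 0 := by
  obtain ⟨T, hT, -, hsum⟩ := hθ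
  rw [hsum]
  exact Finset.sum_eq_zero fun ψ hψ => (hT ψ hψ).1 h hh

theorem IsIrrCharOn.sum_mul_conj_eq_zero [Fintype L] {H : Set L} {ψ φ : L → ℂ}
    (hψ : IsIrrCharOn H ψ) (hφ : IsIrrCharOn H φ) (hne : ψ ≠ φ) :
    ∑ h : L, ψ h * (starRingEnd ℂ) (φ h) = 0 := by
  obtain ⟨hψ0, H₀, rfl, W, hW, hψW⟩ := hψ
  obtain ⟨hφ0, H₁, hH, V, hV, hφV⟩ := hφ
  obtain rfl : H₁ = H₀ := SetLike.coe_injective hH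
  have hinv : Invertible (Nat.card H₁ : ℂ) := invertibleOfNonzero (by simp)
  have hiso : ¬ Nonempty (W ≅ V) := by
    rintro ⟨i⟩
    refine hne (funext fun h => ?_)
    by_cases hh : h ∈ H₁
    · rw [hψW ⟨h, hh⟩, hφV ⟨h, hh⟩, FDRep.char_iso i]
    · rw [hψ0 h hh, hφ0 h hh]
  have key := FDRep.char_orthonormal W V
  rw [if_neg hiso] at key
  have key2 : ∑ g : H₁, W.character g * V.character g⁻¹ = 0 := by
    simpa using key
  rw [← key2]
  have : ∀ g : H₁, W.character g * V.character g⁻¹ = ψ g * (starRingEnd ℂ) (φ g) := fun g => by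
    rw [FDRep.character_inv_eq_conj, hψW, hφV]
  simp only [this]
  refine (Fintype.sum_of_injective _ Subtype.val_injective _ _ (fun h hh => ?_)
    fun _ => rfl).symm
  rw [hψ0 h fun hmem => hh ⟨⟨h, hmem⟩, rfl⟩, zero_mul]

theorem IsOrbitCharOn.sum_mul_conj_eq_zero [Fintype L] {H : Set L} {S : Subgroup L}
    {θ η : L → ℂ} (hθ : IsOrbitCharOn H S θ) (hη : IsOrbitCharOn H S η) (hne : θ ≠ η) :
    ∑ h : L, θ h * (starRingEnd ℂ) (η h) = 0 := by
  obtain ⟨T, hT, ⟨ψ₀, -, hTorb⟩, hTsum⟩ := hθ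
  obtain ⟨T', hT', ⟨φ₀, -, hT'orb⟩, hT'sum⟩ := hη
  have hdisj : ∀ ψ ∈ T, ∀ φ ∈ T', ψ ≠ φ := by
    rintro ψ hψ _ hφ rfl
    refine hne (funext fun h => ?_)
    rw [hTsum, hT'sum]
    congr 1
    obtain ⟨r, hr, hr'⟩ := (hTorb ψ).1 hψ
    obtain ⟨q, hq, hq'⟩ := (hT'orb ψ).1 hφ
    have e1 : ∀ h, φ₀ h = ψ₀ (r * q⁻¹ * h * (r * q⁻¹)⁻¹) := fun h => by
      have := hq' (q⁻¹ * h * q)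
      rw [hr'] at this
      rw [show q * (q⁻¹ * h * q) * q⁻¹ = h by group] at this
      rw [← this]; congr 1; group
    have e2 : ∀ h, ψ₀ h = φ₀ (q * r⁻¹ * h * (q * r⁻¹)⁻¹) := fun h => by
      rw [e1]; congr 1; group
    ext χ
    rw [hTorb, hT'orb]
    constructor
    · rintro ⟨p, hp, h⟩
      refine ⟨q * r⁻¹ * p, S.mul_mem (S.mul_mem hq (S.inv_mem hr)) hp, fun x => ?_⟩
      rw [h, e2]; congr 1; group
    · rintro ⟨p, hp, h⟩
      refine ⟨r * q⁻¹ * p, S.mul_mem (S.mul_mem hr (S.inv_mem hq)) hp, fun x => ?_⟩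
      rw [h, e1]; congr 1; group
  simp only [hTsum, hT'sum, map_sum, Finset.sum_mul_sum]
  rw [Finset.sum_comm]
  refine Finset.sum_eq_zero fun ψ hψ => ?_
  rw [Finset.sum_comm]
  exact Finset.sum_eq_zero fun φ hφ =>
    (hT ψ hψ).sum_mul_conj_eq_zero (hT' φ hφ) (hdisj ψ hψ φ hφ)

theorem IsIrrCharOn.conj {H : Set L} {ψ : L → ℂ} (hψ : IsIrrCharOn H ψ) (a : L) :
    IsIrrCharOn {h | a * h * a⁻¹ ∈ H} (fun h => ψ (a * h * a⁻¹)) := by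
  obtain ⟨h0, H₀, rfl, W, hW, hWψ⟩ := hψ
  refine ⟨fun h hh => h0 _ hh, H₀.comap (MulAut.conj a).toMonoidHom, rfl, ?_⟩
  let e : ↥(H₀.comap (MulAut.conj a).toMonoidHom) ≃* H₀ :=
    { toFun := fun h => ⟨a * h * a⁻¹, h.2⟩
      invFun := fun h => ⟨a⁻¹ * h * a, by
        simp [mul_assoc]⟩
      left_inv := fun h => by ext; simp [mul_assoc]
      right_inv := fun h => by ext; simp [mul_assoc]
      map_mul' := fun h k => by
        ext; change a * (h * k : L) * a⁻¹ = _; simp [mul_assoc] }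
  refine ⟨(Action.resEquiv (FGModuleCat ℂ) e).functor.obj W,
    (CategoryTheory.simple_obj_iff _ W).2 hW, fun h => ?_⟩
  exact hWψ (e h)

theorem IsOrbitCharOn.conj {H S : Set L} {θ : L → ℂ} (hθ : IsOrbitCharOn H S θ) (a : L) :
    IsOrbitCharOn {h | a * h * a⁻¹ ∈ H} {h | a * h * a⁻¹ ∈ S} (fun h => θ (a * h * a⁻¹)) := by
  obtain ⟨T, hT, ⟨ψ₀, hψ₀, hTorb⟩, hTsum⟩ := hθ
  let c : (L → ℂ) → (L → ℂ) := fun ψ h => ψ (a * h * a⁻¹)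
  have hc : Function.Injective c := fun ψ φ h => funext fun x => by
    have := congrFun h (a⁻¹ * x * a)
    simpa [c, mul_assoc] using this
  refine ⟨T.image c, ?_, ⟨c ψ₀, Finset.mem_image_of_mem c hψ₀, fun ψ => ?_⟩, fun h => ?_⟩
  · simp only [Finset.mem_image]
    rintro _ ⟨ψ, hψ, rfl⟩
    exact (hT ψ hψ).conj a
  · simp only [Finset.mem_image]
    constructor
    · rintro ⟨ψ, hψ, rfl⟩
      obtain ⟨r, hr, h⟩ := (hTorb ψ).1 hψ
      refine ⟨a⁻¹ * r * a, by simpa [mul_assoc] using hr, fun x => ?_⟩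
      simp only [c, h]; congr 1; group
    · rintro ⟨r, hr, h⟩
      refine ⟨fun x => ψ (a⁻¹ * x * a), (hTorb _).2 ⟨_, hr, fun x => ?_⟩, ?_⟩
      · simp only [c, h]; congr 1; group
      · funext x; simp [c, mul_assoc]
  · rw [Finset.sum_image fun _ _ _ _ h => hc h]
    exact hTsum _

end Characters

/-- Commuting left and right linear actions of a group `L` on a non-unital algebra `J`, compatible
with the product, such that every element of `J` has an inverse for `x + y + x * y`. -/
structure AlgebraGroupAction (F J L : Type) [Field F] [NonUnitalRing J] [Module F J]
    [Group L] where
  l : L → J →ₗ[F] J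
  r : L → J →ₗ[F] J
  l_one : ∀ x, l 1 x = x
  l_l : ∀ h k x, l h (l k x) = l (h * k) x
  r_one : ∀ x, r 1 x = x
  r_r : ∀ h k x, r k (r h x) = r (h * k) x
  r_l : ∀ h k x, r k (l h x) = l h (r k x)
  l_mul : ∀ h x y, l h (x * y) = l h x * y
  r_mul : ∀ h x y, r h (x * y) = x * r h y
  mul_l : ∀ h x y, x * l h y = r h x * y
  exists_circ_inv : ∀ w : J, ∃ v : J, w + v + w * v = 0 ∧ v + w + v * w = 0

namespace AlgebraGroupAction

variable {F J L : Type} [Field F] [NonUnitalRing J] [Module F J]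
  [Group L] (A : AlgebraGroupAction F J L)

/-- The orbit of `l` under the two-sided action on the dual of `J`. -/
def orbit (l : Module.Dual F J) : Set (Module.Dual F J) :=
  {μ | ∃ (k : L) (w z : J), ∀ x : J,
    μ x = l (A.r k (x + z * x) + A.r k (x + z * x) * w)}

/-- The coadjoint action of `L` on the dual of `J`. -/
def coad (a : L) (μ : Module.Dual F J) : Module.Dual F J := μ ∘ₗ A.r a ∘ₗ A.l a⁻¹

theorem coad_apply (a : L) (μ : Module.Dual F J) (x : J) :
    A.coad a μ x = μ (A.r a (A.l a⁻¹ x)) := rfl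

/-- The elements of `L` fixing the orbit of `l` pointwise. -/
def fixer (l : Module.Dual F J) : Set L :=
  {h | ∀ μ ∈ A.orbit l, ∀ x : J, μ (A.r h (A.l h⁻¹ x)) = μ x}

theorem coad_coad (a b : L) (μ : Module.Dual F J) : A.coad a (A.coad b μ) = A.coad (a * b) μ := by
  ext x
  simp only [coad_apply, A.r_l, A.l_l, A.r_r, mul_inv_rev]

theorem coad_one (μ : Module.Dual F J) : A.coad 1 μ = μ := by
  ext x
  simp [coad_apply, A.l_one, A.r_one]

/-- The setwise stabilizer in `L` of the orbit of `l`. -/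
def stab (l : Module.Dual F J) : Subgroup L where
  carrier := {h | ∀ μ, μ ∈ A.orbit l ↔ A.coad h μ ∈ A.orbit l}
  one_mem' μ := by rw [coad_one]
  mul_mem' {a b} ha hb μ := by rw [hb, ha, coad_coad]
  inv_mem' {a} ha μ := by rw [ha (A.coad a⁻¹ μ), coad_coad, mul_inv_cancel, coad_one]

theorem orbit_trans {l μ ν : Module.Dual F J} (h : μ ∈ A.orbit l) (h' : ν ∈ A.orbit μ) :
    ν ∈ A.orbit l := by
  obtain ⟨k, w, z, h⟩ := h
  obtain ⟨k', w', z', h'⟩ := h'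
  refine ⟨k' * k, A.l k⁻¹ (A.r k w') + w + A.l k⁻¹ (A.r k w' * w), z + z' + z * z',
    fun x => ?_⟩
  rw [h', h]
  congr 1
  simp only [mul_add, add_mul, map_add, A.r_mul, A.r_r, A.mul_l, mul_assoc,
    mul_inv_cancel, mul_one]
  abel

theorem orbit_symm {l μ : Module.Dual F J} (h : μ ∈ A.orbit l) : l ∈ A.orbit μ := by
  obtain ⟨k, w, z, h⟩ := h
  obtain ⟨w', -, hw'⟩ := A.exists_circ_inv w
  obtain ⟨z', hz, -⟩ := A.exists_circ_inv z
  refine ⟨k⁻¹, A.l k (A.r k⁻¹ w'), z', fun x => ?_⟩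
  rw [h]
  congr 1
  have e1 : ∀ y, A.r k⁻¹ y + A.r k⁻¹ y * A.l k (A.r k⁻¹ w') = A.r k⁻¹ (y + y * w') := fun y => by
    simp only [map_add, A.mul_l, A.r_r, A.r_mul, inv_mul_cancel, A.r_one]
  have e2 : (x + z' * x) + z * (x + z' * x) = x + (z + z' + z * z') * x := by noncomm_ring
  have e3 : (x + x * w') + (x + x * w') * w = x + x * (w' + w + w' * w) := by noncomm_ring
  rw [e1]
  have e4 : A.r k⁻¹ (x + z' * x + (x + z' * x) * w') +
      z * A.r k⁻¹ (x + z' * x + (x + z' * x) * w') =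
      A.r k⁻¹ (((x + z' * x) + z * (x + z' * x)) + ((x + z' * x) + z * (x + z' * x)) * w') := by
    simp only [map_add, A.r_mul, mul_add, add_mul, mul_assoc]
    abel
  rw [e4, e2, hz, zero_mul, add_zero, A.r_r, inv_mul_cancel, A.r_one, e3, hw', mul_zero,
    add_zero]

theorem orbit_eq_of_mem {l m : Module.Dual F J} (h : m ∈ A.orbit l) : A.orbit m = A.orbit l :=
  Set.ext fun _ => ⟨A.orbit_trans h, A.orbit_trans (A.orbit_symm h)⟩

theorem coad_mem_orbit {l μ : Module.Dual F J} (a : L) (h : μ ∈ A.orbit l) :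
    A.coad a μ ∈ A.orbit (A.coad a l) := by
  obtain ⟨k, w, z, h⟩ := h
  refine ⟨a * k * a⁻¹, A.l a (A.r a⁻¹ w), A.l a (A.r a⁻¹ z), fun x => ?_⟩
  rw [coad_apply, coad_apply, h]
  congr 1
  simp only [add_mul, map_add, A.r_mul, A.r_r, A.mul_l, A.l_mul, A.l_l, A.r_l, mul_assoc,
    inv_mul_cancel, mul_one, A.l_one, A.r_one]

theorem coad_mem_orbit_iff {l μ : Module.Dual F J} (a : L) :
    A.coad a μ ∈ A.orbit (A.coad a l) ↔ μ ∈ A.orbit l := by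
  refine ⟨fun h => ?_, A.coad_mem_orbit a⟩
  have := A.coad_mem_orbit a⁻¹ h
  simpa only [coad_coad, inv_mul_cancel, coad_one] using this

theorem mem_fixer_iff (l : Module.Dual F J) (h : L) :
    h ∈ A.fixer l ↔ ∀ μ ∈ A.orbit l, A.coad h μ = μ := by
  refine forall₂_congr fun μ _ => ?_
  rw [LinearMap.ext_iff]
  rfl

theorem fixer_coad (a : L) (l : Module.Dual F J) :
    A.fixer (A.coad a⁻¹ l) = {h | a * h * a⁻¹ ∈ A.fixer l} := by
  ext h
  rw [Set.mem_ofPred_eq, mem_fixer_iff, mem_fixer_iff]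
  constructor
  · intro H μ hμ
    have := congrArg (A.coad a) (H _ (A.coad_mem_orbit a⁻¹ hμ))
    simpa only [coad_coad, mul_inv_cancel, coad_one, mul_assoc] using this
  · intro H μ hμ
    have hμ' : A.coad a μ ∈ A.orbit l := by
      rwa [← A.coad_mem_orbit_iff a⁻¹, coad_coad, inv_mul_cancel, coad_one]
    have := congrArg (A.coad a⁻¹) (H _ hμ')
    simpa only [coad_coad, mul_assoc, inv_mul_cancel_left, inv_mul_cancel, mul_one, coad_one]
      using this

theorem stab_coad (a : L) (l : Module.Dual F J) :
    (A.stab (A.coad a⁻¹ l) : Set L) = {h | a * h * a⁻¹ ∈ A.stab l} := by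
  ext h
  change (∀ μ, _ ↔ _) ↔ (∀ μ, _ ↔ _)
  constructor
  · intro H μ
    have := H (A.coad a⁻¹ μ)
    rw [coad_mem_orbit_iff, coad_coad] at this
    rw [this, ← A.coad_mem_orbit_iff (l := l) a⁻¹, coad_coad]
    simp only [mul_assoc, inv_mul_cancel_left]
  · intro H μ
    have := H (A.coad a μ)
    rw [← A.coad_mem_orbit_iff a⁻¹, ← A.coad_mem_orbit_iff (l := l) a⁻¹] at this
    simpa only [coad_coad, mul_assoc, inv_mul_cancel_left, inv_mul_cancel, mul_one, coad_one]
      using this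

/-- The elements `z` of `J` with `l (z * w) = 0` for all `w`. -/
def rad (l : Module.Dual F J) : Set J := {z | ∀ w, l (z * w) = 0}

theorem mem_orbit_r (l : Module.Dual F J) (p : L) : l ∘ₗ A.r p ∈ A.orbit l :=
  ⟨p, 0, 0, fun x => by simp⟩

theorem mem_orbit_mul [SMulCommClass F J J] (l : Module.Dual F J) (w : J) :
    l ∘ₗ (LinearMap.id + LinearMap.mulLeft F w) ∈ A.orbit l :=
  ⟨1, 0, w, fun x => by simp [A.r_one]⟩

theorem apply_mul_of_mem_fixer [SMulCommClass F J J] {l : Module.Dual F J} {h : L} (hh : h ∈ A.fixer l) (w z : J) :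
    l (A.r h (A.l h⁻¹ w) * z) = l (w * z) := by
  have h1 := hh _ (A.mem_orbit_mul l w) (A.l h (A.r h⁻¹ z))
  have h2 := hh _ (A.mem_orbit_r l 1) (A.l h (A.r h⁻¹ z))
  have h3 := hh _ (A.mem_orbit_r l 1) (w * A.l h (A.r h⁻¹ z))
  simp only [LinearMap.comp_apply, LinearMap.add_apply, LinearMap.id_apply,
    LinearMap.mulLeft_apply, A.r_one, A.l_l, A.r_r, A.l_one, inv_mul_cancel, A.l_mul,
    A.mul_l, A.r_mul, map_add] at h1 h2 h3
  rw [A.r_l, h3]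
  linear_combination -h1 + h2

theorem circ_mem_rad_iff (A : AlgebraGroupAction F J L) {l : Module.Dual F J} {y : J} (hy : y ∈ rad l) (x : J) :
    x + y + x * y ∈ rad l ↔ x ∈ rad l := by
  constructor
  · intro h z
    obtain ⟨y', hy', -⟩ := A.exists_circ_inv y
    have h1 := h (z + y' * z)
    have h2 := hy (z + y' * z)
    have e : (x + y + x * y) * (z + y' * z) =
        x * z + x * ((y + y' + y * y') * z) + y * (z + y' * z) := by noncomm_ring
    rw [e, hy', map_add, map_add, h2] at h1
    simpa using h1
  · intro h z
    rw [add_mul, add_mul, map_add, map_add, h, hy, mul_assoc, h]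
    simp

variable (ε : AddChar F ℂ)

/-- The function `h (1 + x) ↦ θ h * ε (l (x p))` on the product of the fixer of the orbit of `l` and
`1 + rad l`, extended by zero. -/
noncomputable def xiAt (θ : L → ℂ) (l : Module.Dual F J) (p h : L) (x : J) : ℂ :=
  if h ∈ A.fixer l ∧ x ∈ rad l then θ h * ε (l (A.r p x)) else 0

theorem xiAt_circ (θ : L → ℂ) {l : Module.Dual F J} (p h : L) (x : J) {y : J} (hy : y ∈ rad l) :
    A.xiAt ε θ l p h (x + y + x * y) = A.xiAt ε θ l p h x * ε (l (A.r p y)) := by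
  unfold xiAt
  rw [A.circ_mem_rad_iff hy]
  split_ifs with hx
  · have := hx.2 (A.r p y)
    rw [map_add (A.r p), map_add (A.r p), A.r_mul, map_add l, map_add l, this, add_zero, AddChar.map_add_eq_mul,
      mul_assoc]
  · simp

/-- The function `h (1 + x) ↦ ∑ p, θ h * ε (l (x p))`, extended by zero. -/
noncomputable def xi [Fintype L] (θ : L → ℂ) (l : Module.Dual F J) (h : L) (x : J) : ℂ :=
  if h ∈ A.fixer l ∧ x ∈ rad l then ∑ p : L, θ h * ε (l (A.r p x)) else 0

theorem xi_eq_sum_xiAt [Fintype L] (θ : L → ℂ) (l : Module.Dual F J) (h : L) (x : J) :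
    A.xi ε θ l h x = ∑ p : L, A.xiAt ε θ l p h x := by
  unfold xi xiAt
  split_ifs <;> simp

theorem xi_coad [Fintype L] (θ : L → ℂ) (l : Module.Dual F J) (a h : L) (x : J) :
    A.xi ε θ l (a * h * a⁻¹) (A.l a (A.r a⁻¹ x)) =
      A.xi ε (fun h => θ (a * h * a⁻¹)) (A.coad a⁻¹ l) h x := by
  have hrad : A.l a (A.r a⁻¹ x) ∈ rad l ↔ x ∈ rad (A.coad a⁻¹ l) := by
    constructor
    · intro hx z
      have := hx (A.l a (A.r a⁻¹ z))
      simpa only [coad_apply, A.r_l, A.l_l, A.r_r, A.mul_l, A.l_mul, A.r_mul, inv_mul_cancel,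
        A.r_one, inv_inv] using this
    · intro hx z
      have := hx (A.l a⁻¹ (A.r a z))
      simpa only [coad_apply, A.r_l, A.l_l, A.r_r, A.mul_l, A.l_mul, A.r_mul, mul_inv_cancel,
        A.r_one, inv_inv] using this
  unfold xi
  rw [hrad, A.fixer_coad]
  refine if_congr Iff.rfl ?_ rfl
  refine Fintype.sum_equiv (MulAut.conj a⁻¹).toEquiv _ _ fun p => ?_
  simp [coad_apply, A.r_l, A.r_r, mul_assoc]

variable [SMulCommClass F J J] [IsScalarTower F J J]

/-- Conjugation `y ↦ (1 + w) y (1 + v)`. -/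
def conjMap (w v : J) : J →ₗ[F] J :=
  LinearMap.id + LinearMap.mulLeft F w + LinearMap.mulRight F v +
    LinearMap.mulRight F v ∘ₗ LinearMap.mulLeft F w

theorem conjMap_apply (w v y : J) : conjMap (F := F) w v y = y + w * y + y * v + w * y * v := rfl

theorem mem_orbit_of_agree [Finite J] {l m : Module.Dual F J} {p q : L} {w v : J}
    (h : ∀ y, y ∈ rad l → conjMap (F := F) w v y ∈ rad m →
      l (A.r p y) = m (A.r q (conjMap (F := F) w v y))) :
    m ∈ A.orbit l := by
  have : Module.Finite F J := Module.Finite.of_finite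
  let c := conjMap (F := F) w v
  let φ : J →ₗ[F] Module.Dual F J := (LinearMap.mul F J).flip.compr₂ l
  let ψ : J →ₗ[F] Module.Dual F J := ((LinearMap.mul F J).flip.compr₂ m).compl₂ c
  have hφ : ∀ z y, φ z y = l (y * z) := fun z y => rfl
  have hψ : ∀ z y, ψ z y = m (c y * z) := fun z y => rfl
  have hmem : l ∘ₗ A.r p - m ∘ₗ A.r q ∘ₗ c ∈ LinearMap.range φ ⊔ LinearMap.range ψ := by
    rw [← Subspace.dualCoannihilator_dualAnnihilator_eq (W := LinearMap.range φ ⊔ LinearMap.range ψ),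
      Submodule.mem_dualAnnihilator]
    intro y hy
    rw [Submodule.mem_dualCoannihilator] at hy
    rw [LinearMap.sub_apply, sub_eq_zero]
    refine h y (fun z => ?_) fun z => ?_
    · exact hy (φ z) (Submodule.mem_sup_left ⟨z, rfl⟩)
    · exact hy (ψ z) (Submodule.mem_sup_right ⟨z, rfl⟩)
  obtain ⟨_, ⟨z, rfl⟩, _, ⟨z', rfl⟩, hz⟩ := Submodule.mem_sup.1 hmem
  have hz' : ∀ y, l (A.r p y) - l (y * z) = m (A.r q (c y)) + m (c y * z') := fun y => by
    have := LinearMap.congr_fun hz y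
    simp only [LinearMap.add_apply, LinearMap.sub_apply, LinearMap.comp_apply, hφ, hψ] at this
    linear_combination -this
  let ν : Module.Dual F J := l ∘ₗ A.r p - φ z
  have h1 : ν ∈ A.orbit l := by
    refine ⟨p, - A.l p⁻¹ z, 0, fun y => ?_⟩
    simp [ν, hφ, A.mul_l, A.r_r, A.r_one, sub_eq_add_neg]
  have h2 : ν ∈ A.orbit m := by
    refine ⟨q, A.l q⁻¹ (A.r q v) + A.l q⁻¹ z' + A.l q⁻¹ v * z', w, fun y => ?_⟩
    rw [show ν y = l (A.r p y) - l (y * z) from rfl, hz', ← map_add]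
    congr 1
    simp only [c, conjMap_apply, map_add, add_mul, mul_add, A.r_mul, A.mul_l, A.r_r,
      mul_inv_cancel, A.r_one, mul_assoc, ← A.l_mul]
    abel
  exact A.orbit_trans h1 (A.orbit_symm h2)


theorem sum_xiAt_mul_conj_eq_zero [Finite F] [Fintype J] (hε : ε ≠ 1) {l m : Module.Dual F J}
    (hlm : m ∉ A.orbit l) (θ η : L → ℂ) (p q h : L) (w' : J) {w v : J}
    (hvw : v + w + v * w = 0) :
    ∑ x : J, A.xiAt ε θ l p h x *
      (starRingEnd ℂ) (A.xiAt ε η m q h (w' + x + w' * x + v + (w' + x + w' * x) * v)) = 0 := by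
  have hex : ∃ y, y ∈ rad l ∧ conjMap (F := F) w v y ∈ rad m ∧
      l (A.r p y) - m (A.r q (conjMap (F := F) w v y)) ≠ 0 := by
    by_contra hcon
    refine hlm (A.mem_orbit_of_agree (p := p) (q := q) (w := w) (v := v) fun y hy hy' => ?_)
    by_contra hne
    exact hcon ⟨y, hy, hy', sub_ne_zero.2 hne⟩
  obtain ⟨y₀, hy₀, hcy₀, hne⟩ := hex
  obtain ⟨t, ht⟩ := AddChar.ne_one_iff.1 hε
  obtain ⟨y, hy, hcy, hδ⟩ : ∃ y, y ∈ rad l ∧ conjMap (F := F) w v y ∈ rad m ∧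
      l (A.r p y) - m (A.r q (conjMap (F := F) w v y)) = t := by
    refine ⟨(t / (l (A.r p y₀) - m (A.r q (conjMap (F := F) w v y₀)))) • y₀, fun z => ?_,
      fun z => ?_, ?_⟩
    · rw [smul_mul_assoc, map_smul, hy₀, smul_zero]
    · rw [map_smul, smul_mul_assoc, map_smul, hcy₀, smul_zero]
    · simp only [map_smul, smul_eq_mul]
      rw [← mul_sub, div_mul_cancel₀ _ hne]
  obtain ⟨y', hyy', hy'y⟩ := A.exists_circ_inv y
  let e : J ≃ J :=
    { toFun := fun x => x + y + x * y
      invFun := fun x => x + y' + x * y'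
      left_inv := fun x => by
        have : x + y + x * y + y' + (x + y + x * y) * y' =
          x + (y + y' + y * y') + x * (y + y' + y * y') := by noncomm_ring
        simp [this, hyy']
      right_inv := fun x => by
        have : x + y' + x * y' + y + (x + y' + x * y') * y =
          x + (y' + y + y' * y) + x * (y' + y + y' * y) := by noncomm_ring
        simp [this, hy'y] }
  let f : J → ℂ := fun x => A.xiAt ε θ l p h x *
      (starRingEnd ℂ) (A.xiAt ε η m q h (w' + x + w' * x + v + (w' + x + w' * x) * v))
  have hf : ∀ x, f (e x) = ε t * f x := fun x => by
    have hx : w' + e x + w' * e x + v + (w' + e x + w' * e x) * v =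
        (w' + x + w' * x + v + (w' + x + w' * x) * v) + conjMap (F := F) w v y +
        (w' + x + w' * x + v + (w' + x + w' * x) * v) * conjMap (F := F) w v y := by
      rw [← sub_eq_zero]
      have : (w' + e x + w' * e x + v + (w' + e x + w' * e x) * v) -
          ((w' + x + w' * x + v + (w' + x + w' * x) * v) + conjMap (F := F) w v y +
          (w' + x + w' * x + v + (w' + x + w' * x) * v) * conjMap (F := F) w v y) =
          - ((v + w + v * w) * (y + y * v) + (w' + x + w' * x) *
            ((v + w + v * w) * (y + y * v))) := by
        simp only [conjMap_apply, e, Equiv.coe_fn_mk]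
        noncomm_ring
      rw [this, hvw]
      simp
    simp only [f]
    rw [hx, A.xiAt_circ ε η q h _ hcy, show e x = x + y + x * y from rfl,
      A.xiAt_circ ε θ p h _ hy, map_mul, ← AddChar.map_neg_eq_conj, ← hδ, sub_eq_add_neg,
      AddChar.map_add_eq_mul]
    ring
  have hsum : ∑ x, f x = ε t * ∑ x, f x := by
    rw [Finset.mul_sum, ← Equiv.sum_comp e]
    exact Finset.sum_congr rfl fun x _ => hf x
  change ∑ x, f x = 0
  have : (ε t - 1) * ∑ x, f x = 0 := by rw [sub_mul, ← hsum, one_mul, sub_self]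
  exact (mul_eq_zero.1 this).resolve_left (sub_ne_zero.2 ht)

theorem xiAt_conj_of_mem_fixer (η : L → ℂ) {m : Module.Dual F J} (q : L) {h : L}
    (hh : h ∈ A.fixer m) (x : J) {w v : J} (hwv : w + v + w * v = 0) :
    A.xiAt ε η m q h (A.r h (A.l h⁻¹ w) + x + A.r h (A.l h⁻¹ w) * x + v +
      (A.r h (A.l h⁻¹ w) + x + A.r h (A.l h⁻¹ w) * x) * v) =
    η h * if conjMap (F := F) w v x ∈ rad m then
      ε (m (A.r q (conjMap (F := F) w v x))) else 0 := by
  set w' := A.r h (A.l h⁻¹ w) with hw'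
  have hd : ∀ z, m ((w' - w) * z) = 0 := fun z => by
    rw [sub_mul, map_sub, A.apply_mul_of_mem_fixer hh, sub_self]
  have hdq : m (A.r q (w' - w)) = 0 := by
    have := hh _ (A.mem_orbit_r m q) w
    rw [map_sub, map_sub, sub_eq_zero]
    exact this
  have hx : w' + x + w' * x + v + (w' + x + w' * x) * v =
      conjMap (F := F) w v x + (w' - w) + (w' - w) * (v + x + x * v) := by
    rw [← sub_eq_zero]
    have : w' + x + w' * x + v + (w' + x + w' * x) * v -
      (conjMap (F := F) w v x + (w' - w) + (w' - w) * (v + x + x * v)) =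
        w + v + w * v := by
      simp only [conjMap_apply]
      noncomm_ring
    rw [this, hwv]
  have hrad : w' + x + w' * x + v + (w' + x + w' * x) * v ∈ rad m ↔
      conjMap (F := F) w v x ∈ rad m := by
    refine forall_congr' fun z => ?_
    rw [hx, add_mul, add_mul, map_add, map_add, mul_assoc, hd, hd, add_zero, add_zero]
  have hval : m (A.r q (w' + x + w' * x + v + (w' + x + w' * x) * v)) =
      m (A.r q (conjMap (F := F) w v x)) := by
    rw [hx, map_add, map_add, map_add, map_add, hdq, A.r_mul, hd, add_zero, add_zero]
  rw [xiAt, hrad, hval]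
  simp [hh]

theorem sum_xi_mul_conj_eq_zero [Finite F] [Fintype J] [Fintype L] (hε : ε ≠ 1)
    {l m : Module.Dual F J} {θ η : L → ℂ} (hθ : IsOrbitCharOn (A.fixer l) (A.stab l) θ)
    (hη : IsOrbitCharOn (A.fixer m) (A.stab m) η) (hne : m ∈ A.orbit l → θ ≠ η) {w v : J}
    (hwv : w + v + w * v = 0) (hvw : v + w + v * w = 0) :
    ∑ h : L, ∑ x : J, A.xi ε θ l h x *
      (starRingEnd ℂ) (A.xi ε η m h (A.r h (A.l h⁻¹ w) + x + A.r h (A.l h⁻¹ w) * x + v +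
        (A.r h (A.l h⁻¹ w) + x + A.r h (A.l h⁻¹ w) * x) * v)) = 0 := by
  by_cases hlm : m ∈ A.orbit l
  · have horb := A.orbit_eq_of_mem hlm
    have hfix : A.fixer m = A.fixer l := by simp only [fixer, horb]
    have hstab : A.stab m = A.stab l := by simp only [stab, horb]
    rw [hfix, hstab] at hη
    have key := hθ.sum_mul_conj_eq_zero hη (hne hlm)
    refine Eq.trans (b := (∑ h : L, θ h * (starRingEnd ℂ) (η h)) * ∑ x : J, (∑ p : L, if x ∈ rad l then ε (l (A.r p x)) else 0) *
      (starRingEnd ℂ) (∑ q : L, if conjMap (F := F) w v x ∈ rad m then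
        ε (m (A.r q (conjMap (F := F) w v x))) else 0)) ?_ (by rw [key, zero_mul])
    rw [Finset.sum_mul]
    refine Finset.sum_congr rfl fun h _ => ?_
    rw [Finset.mul_sum]
    refine Finset.sum_congr rfl fun x _ => ?_
    by_cases hh : h ∈ A.fixer l
    · rw [xi_eq_sum_xiAt, xi_eq_sum_xiAt]
      simp only [A.xiAt_conj_of_mem_fixer ε η _ (hfix ▸ hh) x hwv, ← Finset.mul_sum, map_mul]
      have : ∀ p, A.xiAt ε θ l p h x = θ h * if x ∈ rad l then ε (l (A.r p x)) else 0 :=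
        fun p => by simp [xiAt, hh]
      simp only [this, ← Finset.mul_sum]
      ring
    · rw [hθ.apply_eq_zero hh]
      simp [xi, hh]
  · refine Finset.sum_eq_zero fun h _ => ?_
    simp only [xi_eq_sum_xiAt, map_sum, Finset.sum_mul_sum]
    rw [Finset.sum_comm]
    refine Finset.sum_eq_zero fun p _ => ?_
    rw [Finset.sum_comm]
    exact Finset.sum_eq_zero fun q _ =>
      A.sum_xiAt_mul_conj_eq_zero ε hε hlm θ η p q h _ hvw

end AlgebraGroupAction

/-- Induced class functions are orthogonal when one is orthogonal to every conjugate of the other. -/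
theorem sum_induced_mul_conj_eq_zero {G : Type} [Group G] [Fintype G] (f f' : G → ℂ)
    (h : ∀ s, ∑ g, f g * (starRingEnd ℂ) (f' (s * g * s⁻¹)) = 0) (c c' : ℂ) :
    ∑ g : G, (c * ∑ s : G, f (s * g * s⁻¹)) *
      (starRingEnd ℂ) (c' * ∑ t : G, f' (t * g * t⁻¹)) = 0 := by
  have key : ∑ g : G, (∑ s : G, f (s * g * s⁻¹)) *
      (starRingEnd ℂ) (∑ t : G, f' (t * g * t⁻¹)) = 0 := by
    simp only [map_sum, Finset.sum_mul_sum]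
    rw [Finset.sum_comm]
    refine Finset.sum_eq_zero fun s _ => ?_
    rw [Finset.sum_comm]
    refine Finset.sum_eq_zero fun t _ => ?_
    rw [← h (t * s⁻¹)]
    refine Fintype.sum_equiv (MulAut.conj s).toEquiv _ _ fun g => ?_
    simp [mul_assoc]
  calc _ = c * (starRingEnd ℂ) c' * ∑ g : G, (∑ s : G, f (s * g * s⁻¹)) *
      (starRingEnd ℂ) (∑ t : G, f' (t * g * t⁻¹)) := by
        rw [Finset.mul_sum]
        refine Finset.sum_congr rfl fun g _ => ?_
        rw [map_mul]
        ring
    _ = 0 := by rw [key, mul_zero]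

theorem stmt_14
    (F : Type) [Field F] [Fintype F]
    (J : Type) [NonUnitalRing J] [Module F J]
    [SMulCommClass F J J] [IsScalarTower F J J] [Fintype J]
    (hnil : ∃ N : ℕ, ∀ x : ℕ → J,
      (List.range N).foldr (fun i acc => x i * acc) (x N) = 0)
    (L : Type) [Group L] [Fintype L]
    (lact : L → J → J) (ract : J → L → J)
    (hlactlin : ∀ h : L, IsLinearMap F (lact h))
    (hractlin : ∀ h : L, IsLinearMap F (fun x => ract x h))
    (hlact_one : ∀ x : J, lact 1 x = x)
    (hlact_mul : ∀ h k : L, ∀ x : J, lact (h * k) x = lact h (lact k x))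
    (hract_one : ∀ x : J, ract x 1 = x)
    (hract_mul : ∀ h k : L, ∀ x : J, ract x (h * k) = ract (ract x h) k)
    (hcomm : ∀ h k : L, ∀ x : J, ract (lact h x) k = lact h (ract x k))
    (hlmul : ∀ h : L, ∀ x y : J, lact h (x * y) = lact h x * y)
    (hrmul : ∀ h : L, ∀ x y : J, ract (x * y) h = x * ract y h)
    (hmid : ∀ h : L, ∀ x y : J, x * lact h y = ract x h * y)
    (G : Type) [Group G] [Fintype G]
    (ρ : L →* G) (em : J → G)
    (hem : ∀ x y : J, em x * em y = em (x + y + x * y))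
    (hsplit : Function.Bijective (fun p : L × J => ρ p.1 * em p.2))
    (hconj : ∀ (h : L) (x : J), ρ h * em x * (ρ h)⁻¹ = em (lact h (ract x h⁻¹)))
    (ε : AddChar F ℂ) (hε : ε ≠ 1)
 :
    let dec : G → L × J :=
      @Function.invFun (L × J) G ⟨(1, 0)⟩ fun p : L × J => ρ p.1 * em p.2
    let Jrt : Module.Dual F J → Set J := fun l => {z : J | ∀ w : J, l (z * w) = 0}
    let GlaU : Module.Dual F J → Set (Module.Dual F J) := fun l =>
      {μ | ∃ (k : L) (w z : J), ∀ x : J,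
        μ x = l (ract (x + z * x) k + ract (x + z * x) k * w)}
    let Fix : L → Module.Dual F J → Prop := fun r μ =>
      ∀ x : J, μ (ract (lact r⁻¹ x) r) = μ x
    let Hset : Module.Dual F J → Set L := fun l => {r : L | ∀ μ ∈ GlaU l, Fix r μ}
    let Sset : Module.Dual F J → Set L := fun l =>
      {r : L | ∀ μ ν : Module.Dual F J,
        (∀ x : J, ν x = μ (ract (lact r⁻¹ x) r)) → (μ ∈ GlaU l ↔ ν ∈ GlaU l)}
    let IsIrrOn : Set L → (L → ℂ) → Prop := fun H ψ =>
      (∀ h : L, h ∉ H → ψ h = 0) ∧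
      ∃ H₀ : Subgroup L, (H₀ : Set L) = H ∧
        ∃ W : FDRep ℂ ↥H₀, CategoryTheory.Simple W ∧
          ∀ h : ↥H₀, ψ ↑h = W.character h
    let IsSIrr : Module.Dual F J → (L → ℂ) → Prop := fun l θ =>
      ∃ Sfin : Finset (L → ℂ),
        (∀ ψ ∈ Sfin, IsIrrOn (Hset l) ψ) ∧
        (∃ ψ₀ ∈ Sfin, ∀ ψ : L → ℂ,
          ψ ∈ Sfin ↔ ∃ r ∈ Sset l, ∀ h : L, ψ h = ψ₀ (r * h * r⁻¹)) ∧
        ∀ h : L, θ h = ∑ ψ ∈ Sfin, ψ h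
    let ξdot : (L → ℂ) → Module.Dual F J → G → ℂ := fun θ l s =>
      if (dec s).1 ∈ Hset l ∧ (dec s).2 ∈ Jrt l then
        ∑ p : L, θ (dec s).1 * ε (l (ract (dec s).2 p))
      else 0
    let χ : (L → ℂ) → Module.Dual F J → G → ℂ := fun θ l g =>
      ((Nat.card ↥(Hset l) * Nat.card ↥(Jrt l) : ℕ) : ℂ)⁻¹ *
        ∑ s : G, ξdot θ l (s * g * s⁻¹)
    let Rel : ((L → ℂ) × Module.Dual F J) → ((L → ℂ) × Module.Dual F J) → Prop :=
      fun α α' => ∃ r : L,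
        (∀ ν : Module.Dual F J,
          (∀ x : J, ν x = α.2 (ract (lact r⁻¹ x) r)) → ν ∈ GlaU α'.2) ∧
        ∀ h : L, α'.1 h = α.1 (r⁻¹ * h * r)
    ∀ R : Set (Module.Dual F J),
      (∀ μ : Module.Dual F J, ∃! l, l ∈ R ∧ μ ∈ GlaU l) →
    let A0 : Set ((L → ℂ) × Module.Dual F J) :=
      {α | α.2 ∈ R ∧ IsSIrr α.2 α.1}
    ∀ α ∈ A0, ∀ α' ∈ A0, ¬ Rel α α' →
      (Fintype.card G : ℂ)⁻¹ *
        (∑ g : G, χ α.1 α.2 g * (starRingEnd ℂ) (χ α'.1 α'.2 g)) = 0 := by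
  intro dec Jrt GlaU Fix Hset Sset IsIrrOn IsSIrr ξdot χ Rel R _ A0 α hα α' hα' hrel
  have hinj : Function.Injective em := fun x y hxy => by
    have : ((1 : L), x) = (1, y) := hsplit.1 (by simp [hxy])
    exact (Prod.mk.inj this).2
  have hem0 : em 0 = 1 := by simpa using hem 0 0
  have hcirc : ∀ w : J, ∃ v : J, w + v + w * v = 0 ∧ v + w + v * w = 0 := fun w => by
    have hw : Function.Injective fun x => w + x + w * x := fun x y hxy => by
      refine hinj (mul_left_cancel (a := em w) ?_)
      rw [hem, hem]
      exact congrArg em hxy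
    obtain ⟨v, hv⟩ := Finite.surjective_of_injective hw 0
    refine ⟨v, hv, hinj ?_⟩
    have h1 : em w * em v = 1 := by rw [hem, ← hem0]; exact congrArg em hv
    rw [← hem, hem0]
    exact mul_eq_one_comm.1 h1
  let A : AlgebraGroupAction F J L :=
    { l := fun h => (hlactlin h).mk' _
      r := fun h => (hractlin h).mk' _
      l_one := hlact_one
      l_l := fun h k x => (hlact_mul h k x).symm
      r_one := hract_one
      r_r := fun h k x => (hract_mul h k x).symm
      r_l := hcomm
      l_mul := hlmul
      r_mul := hrmul
      mul_l := hmid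
      exists_circ_inv := hcirc }
  have hdec : ∀ h x, dec (ρ h * em x) = (h, x) := fun h x =>
    @Function.leftInverse_invFun (L × J) G ⟨(1, 0)⟩ _ hsplit.1 (h, x)
  have hS : ∀ l, Sset l = A.stab l := fun l => Set.ext fun a =>
    ⟨fun h μ => h μ (A.coad a μ) fun _ => rfl, fun h μ ν hν => by
      obtain rfl : ν = A.coad a μ := LinearMap.ext hν
      exact h μ⟩
  have hθ : IsOrbitCharOn (A.fixer α.2) (A.stab α.2) α.1 := hS α.2 ▸ hα.2
  have hθ' : IsOrbitCharOn (A.fixer α'.2) (A.stab α'.2) α'.1 := hS α'.2 ▸ hα'.2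
  have hconj' : ∀ (h : L) (x : J), em x * ρ h = ρ h * em (ract (lact h⁻¹ x) h) := fun h x => by
    have := hconj h⁻¹ x
    rw [inv_inv, ← hcomm] at this
    rw [← this, map_inv]
    group
  refine mul_eq_zero_of_right _ (sum_induced_mul_conj_eq_zero _ _ (fun s => ?_) _ _)
  obtain ⟨⟨a, w⟩, rfl⟩ := hsplit.2 s
  obtain ⟨v, hwv, hvw⟩ := hcirc w
  have hv : (em w)⁻¹ = em v := by
    rw [inv_eq_iff_mul_eq_one, hem, hwv, hem0]
  have hprod : ∀ h x, ρ a * em w * (ρ h * em x) * (ρ a * em w)⁻¹ =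
      ρ (a * h * a⁻¹) * em (A.l a (A.r a⁻¹ (A.r h (A.l h⁻¹ w) + x + A.r h (A.l h⁻¹ w) * x + v +
        (A.r h (A.l h⁻¹ w) + x + A.r h (A.l h⁻¹ w) * x) * v))) := fun h x => by
    have e1 := hconj a (A.r h (A.l h⁻¹ w) + x + A.r h (A.l h⁻¹ w) * x + v +
        (A.r h (A.l h⁻¹ w) + x + A.r h (A.l h⁻¹ w) * x) * v)
    change _ = em (A.l a (A.r a⁻¹ _)) at e1
    have e2 : em w * ρ h = ρ h * em (A.r h (A.l h⁻¹ w)) := hconj' h w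
    rw [← e1, ← hem, ← hem, mul_inv_rev, hv, map_mul, map_mul, map_inv]
    calc _ = ρ a * (em w * ρ h) * em x * em v * (ρ a)⁻¹ := by group
      _ = _ := by rw [e2]; group
  have hstab := A.stab_coad a α'.2
  have key := A.sum_xi_mul_conj_eq_zero ε hε (m := A.coad a⁻¹ α'.2) hθ
    (by rw [A.fixer_coad, hstab]; exact hθ'.conj a) (fun hmem heq => hrel ?_) hwv hvw
  · rw [← Equiv.sum_comp (Equiv.ofBijective _ hsplit), Fintype.sum_prod_type, ← key]
    refine Finset.sum_congr rfl fun h _ => Finset.sum_congr rfl fun x _ => ?_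
    rw [← A.xi_coad]
    have hξ : ∀ θ l h x, ξdot θ l (ρ h * em x) = A.xi ε θ l h x := fun θ l h x => by
      simp only [ξdot, hdec]
      exact if_congr Iff.rfl rfl rfl
    rw [Equiv.ofBijective_apply, hprod, hξ, hξ]
  · refine ⟨a, fun ν hν => ?_, fun h => ?_⟩
    · obtain rfl : ν = A.coad a α.2 := LinearMap.ext hν
      have := A.coad_mem_orbit a (A.orbit_symm hmem)
      rwa [A.coad_coad, mul_inv_cancel, A.coad_one] at this
    · rw [heq]
      simp [mul_assoc]
end

section
/- Let A'₀ = {(θ,λ)}, where λ runs over a set of representatives of the G×U orbits in J* and θ over the S_{GλU}-irreducible characters of H_{GλU}, and let A' be the quotient of A'₀ by the conjugation action of L; for α = (θ,λ) let χ'_α be the character induced to G from Σ_{p∈L} ξ_{θ,pλ} on H_{GλU} ⋉ U_{λ,rt}, where ξ_{θ,pλ}(h(1+x)) = θ(h)·ε^{(pλ)(x)}. For h ∈ L let J'_h = {x ∈ J : μ(x) = 0 for every μ ∈ J* lying in some orbit GνU all of whose elements are fixed by Ad_h*} and π'_h : J → J/J'_h. Let B'₀ = {(h,ω)}, where h ∈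 L and ω runs over the U×G orbits in J/J'_h, let B' be the quotient of B'₀ by the conjugation action of L, and for β = (h,ω) set K'_β = ∪_{p∈L} p·(h·(1+(π'_h)^{-1}(ω)))·p^{-1}. Then ({χ'_α : α ∈ A'}, {K'_β : β ∈ B'}) is a supercharacter theory of G = L ⋉ U: each χ'_α is the character of a complex representation of G, the χ'_α are pairwise orthogonal, the K'_β form a partition of G one of whose parts is {1}, each χ'_α is constant on each K'_β, and |A'| = |B'|. -/
open scoped Classical

section CharacterTheory

open Representation in
theorem Representation.IsIrreducible.sum_smul_eq_zero {H V : Type*} [Group H] [Fintype H]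
    [AddCommGroup V] [Module ℂ V] [FiniteDimensional ℂ V] (σ : Representation ℂ H V)
    [IsIrreducible σ] (f : H → ℂ) (hf : ∀ g h, f (g * h * g⁻¹) = f h)
    (h0 : ∑ h, f h * σ.character h = 0) : ∑ h, f h • σ h = 0 := by
  have hcomm : ∀ g : H, (∑ h, f h • σ h) * σ g = σ g * ∑ h, f h • σ h := by
    intro g
    rw [Finset.sum_mul, Finset.mul_sum]
    refine Fintype.sum_equiv (MulAut.conj g⁻¹).toEquiv _ _ fun h => ?_
    simp only [MulEquiv.toEquiv_eq_coe, EquivLike.coe_coe, MulAut.conj_apply, inv_inv,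
      smul_mul_assoc, mul_smul_comm, ← map_mul]
    have := hf g⁻¹ h
    rw [inv_inv] at this
    rw [this]
    congr 2
    group
  let T : IntertwiningMap σ σ := ⟨∑ h, f h • σ h, fun g => hcomm g⟩
  obtain ⟨c, hc⟩ := (IsIrreducible.algebraMap_intertwiningMap_bijective_of_isAlgClosed
    (ρ := σ)).2 T
  have hc' : ∑ h, f h • σ h = c • (1 : Module.End ℂ V) := by
    have := congrArg (fun S : IntertwiningMap σ σ => S.toLinearMap) hc
    exact this.symm
  have htr := congrArg (LinearMap.trace ℂ V) hc'
  simp only [map_sum, map_smul, smul_eq_mul, LinearMap.trace_one] at htr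
  rw [show ∑ h, f h * LinearMap.trace ℂ V (σ h) = 0 from h0] at htr
  rcases mul_eq_zero.mp htr.symm with h | h
  · rw [hc', h, zero_smul]
  · have : Subsingleton V := Module.finrank_zero_iff.mp (by exact_mod_cast h)
    exact Subsingleton.elim _ _

theorem FDRep.simple_of_isIrreducible {H V : Type} [Group H] [Fintype H]
    [AddCommGroup V] [Module ℂ V] [FiniteDimensional ℂ V] (σ : Representation ℂ H V)
    [Representation.IsIrreducible σ] : CategoryTheory.Simple (FDRep.of σ) := by
  rw [FDRep.simple_iff_char_is_norm_one]
  have hne : (Nat.card H : ℂ) ≠ 0 := Nat.cast_ne_zero.mpr Nat.card_pos.ne'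
  have := invertibleOfNonzero hne
  have h := Representation.char_orthonormal σ σ
  rw [if_pos ⟨Representation.Equiv.refl σ⟩, inv_mul_eq_one₀ hne] at h
  exact h.symm

theorem Representation.ofModule'_asAlgebraHom {H M : Type*} [Group H] [AddCommGroup M]
    [Module ℂ M] [Module (MonoidAlgebra ℂ H) M] [IsScalarTower ℂ (MonoidAlgebra ℂ H) M] :
    (ofModule' (k := ℂ) (G := H) M).asAlgebraHom = Algebra.lsmul ℂ ℂ M :=
  (MonoidAlgebra.lift ℂ (M →ₗ[ℂ] M) H).apply_symm_apply _

theorem Representation.isIrreducible_ofModule' {H M : Type*} [Group H] [AddCommGroup M]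
    [Module ℂ M] [Module (MonoidAlgebra ℂ H) M] [IsScalarTower ℂ (MonoidAlgebra ℂ H) M]
    [IsSimpleModule (MonoidAlgebra ℂ H) M] :
    Representation.IsIrreducible (ofModule' (k := ℂ) (G := H) M) := by
  rw [irreducible_iff_isSimpleModule_asModule]
  let σ := ofModule' (k := ℂ) (G := H) M
  let e : σ.asModule ≃ₗ[MonoidAlgebra ℂ H] M :=
    { σ.asModuleEquiv with
      map_smul' := fun r x => by
        refine (σ.asModuleEquiv_map_smul r x).trans ?_
        rw [Representation.ofModule'_asAlgebraHom]
        rfl }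
  exact IsSimpleModule.congr e

open Representation MonoidAlgebra in
theorem FDRep.sum_single_smul_eq_zero {H M : Type} [Group H] [Fintype H] [AddCommGroup M]
    [Module ℂ M] [Module (MonoidAlgebra ℂ H) M] [IsScalarTower ℂ (MonoidAlgebra ℂ H) M]
    [IsSimpleModule (MonoidAlgebra ℂ H) M] (f : H → ℂ)
    (hf : ∀ g h, f (g * h * g⁻¹) = f h)
    (h0 : ∀ W : FDRep ℂ H, CategoryTheory.Simple W → ∑ h, f h * W.character h = 0) (m : M) :
    (∑ h, single h (f h) : MonoidAlgebra ℂ H) • m = 0 := by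
  let σ := ofModule' (k := ℂ) (G := H) M
  have : Representation.IsIrreducible σ := Representation.isIrreducible_ofModule'
  have : FiniteDimensional ℂ M := Module.Finite.trans (MonoidAlgebra ℂ H) _
  have hs := Representation.IsIrreducible.sum_smul_eq_zero σ f hf
    (h0 (FDRep.of σ) (FDRep.simple_of_isIrreducible σ))
  have hz : σ.asAlgebraHom (∑ h, single h (f h)) = 0 := by
    rw [← hs, map_sum]
    exact Finset.sum_congr rfl fun h _ => asAlgebraHom_single _ _ _
  rw [Representation.ofModule'_asAlgebraHom] at hz
  exact LinearMap.congr_fun hz m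

open MonoidAlgebra in
/-- A class function orthogonal to every irreducible character vanishes. -/
theorem FDRep.eq_zero_of_forall_simple {H : Type} [Group H] [Fintype H] (f : H → ℂ)
    (hf : ∀ g h, f (g * h * g⁻¹) = f h)
    (h0 : ∀ W : FDRep ℂ H, CategoryTheory.Simple W → ∑ h, f h * W.character h = 0) :
    f = 0 := by
  have hz : ∑ h, single h (f h) ∈ Ring.jacobson (MonoidAlgebra ℂ H) := by
    rw [Ring.jacobson, Module.jacobson, Submodule.mem_sInf]
    intro I hI
    have : IsSimpleModule (MonoidAlgebra ℂ H) (MonoidAlgebra ℂ H ⧸ I) :=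
      isSimpleModule_iff_isCoatom.mpr hI
    have := FDRep.sum_single_smul_eq_zero f hf h0
      (Submodule.Quotient.mk 1 : MonoidAlgebra ℂ H ⧸ I)
    rwa [← Submodule.Quotient.mk_smul, Submodule.Quotient.mk_eq_zero, smul_eq_mul,
      mul_one] at this
  have : NeZero (Nat.card H : ℂ) := ⟨Nat.cast_ne_zero.mpr Nat.card_pos.ne'⟩
  rw [IsSemisimpleRing.jacobson_eq_bot, Submodule.mem_bot] at hz
  ext h
  have := congrArg (fun a : MonoidAlgebra ℂ H => a.coeff h) hz
  simpa [Finsupp.finsetSum_apply, Finsupp.single_apply] using this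

open scoped ComplexOrder in
theorem Representation.character_inv_eq_conj {H V : Type*} [Group H] [Fintype H]
    [AddCommGroup V] [Module ℂ V] [FiniteDimensional ℂ V] (σ : Representation ℂ H V) (g : H) :
    σ.character g⁻¹ = starRingEnd ℂ (σ.character g) := by
  let b := Module.finBasis ℂ V
  let D : H →* Matrix (Fin (Module.finrank ℂ V)) (Fin (Module.finrank ℂ V)) ℂ :=
    (LinearMap.toMatrixAlgEquiv b).toRingEquiv.toMonoidHom.comp σ
  have htr : ∀ g, σ.character g = (D g).trace := fun g =>
    LinearMap.trace_eq_matrix_trace ℂ b (σ g)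
  let P := ∑ h, (D h).conjTranspose * D h
  have hP : P.PosDef := by
    have h1 : P = 1 + ∑ h ∈ Finset.univ.erase 1, (D h).conjTranspose * D h := by
      simp only [P]
      rw [← Finset.add_sum_erase _ _ (Finset.mem_univ (1 : H))]
      simp
    rw [h1]
    refine Matrix.PosDef.one.add_posSemidef ?_
    exact Matrix.posSemidef_sum _ fun h _ => Matrix.posSemidef_conjTranspose_mul_self _
  have hinv : (D g).conjTranspose * P * D g = P := by
    simp only [P, Finset.mul_sum, Finset.sum_mul]
    refine Fintype.sum_equiv (Equiv.mulRight g) _ _ fun h => ?_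
    simp [map_mul, Matrix.conjTranspose_mul, mul_assoc]
  have hu : IsUnit P.det := (Matrix.isUnit_iff_isUnit_det _).mp hP.isUnit
  have hgg : D g * D g⁻¹ = 1 := by rw [← map_mul, mul_inv_cancel, map_one]
  have key : P * D g⁻¹ = (D g).conjTranspose * P := by
    calc P * D g⁻¹ = (D g).conjTranspose * P * D g * D g⁻¹ := by rw [hinv]
      _ = _ := by rw [mul_assoc, hgg, mul_one]
  have key2 : D g⁻¹ = P⁻¹ * ((D g).conjTranspose * P) := by
    rw [← key, Matrix.nonsing_inv_mul_cancel_left _ _ hu]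
  rw [htr, htr, key2, Matrix.trace_mul_comm, mul_assoc, Matrix.mul_nonsing_inv _ hu, mul_one,
    Matrix.trace_conjTranspose]
  rfl

end CharacterTheory

section InducedCharacters

theorem LinearMap.trace_pi_eq_sum {ι W : Type*} [Fintype ι] [AddCommGroup W] [Module ℂ W]
    [FiniteDimensional ℂ W] (T : (ι → W) →ₗ[ℂ] (ι → W)) :
    LinearMap.trace ℂ _ T = ∑ i, LinearMap.trace ℂ W
      (LinearMap.proj i ∘ₗ T ∘ₗ LinearMap.single ℂ (fun _ => W) i) := by
  have h : T = ∑ i, (T ∘ₗ LinearMap.single ℂ (fun _ => W) i) ∘ₗ LinearMap.proj i := by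
    refine LinearMap.ext fun v => ?_
    simp only [LinearMap.sum_apply, LinearMap.comp_apply, LinearMap.proj_apply,
      LinearMap.coe_single, ← map_sum]
    congr 1
    exact (Finset.univ_sum_single v).symm
  conv_lhs => rw [h, map_sum]
  exact Finset.sum_congr rfl fun i _ => LinearMap.trace_comp_comm' _ _

/-- `f` is the character of a complex representation of `G`. -/
def IsCharacter {G : Type} [Group G] (f : G → ℂ) : Prop :=
  ∃ W : FDRep ℂ G, ∀ g, f g = W.character g

theorem IsCharacter.zero {G : Type} [Group G] : IsCharacter (0 : G → ℂ) := by
  refine ⟨FDRep.of (1 : Representation ℂ G PUnit), fun g => ?_⟩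
  change 0 = LinearMap.trace ℂ PUnit _
  exact (map_zero _).symm.trans (congrArg (LinearMap.trace ℂ PUnit) (Subsingleton.elim 0 _))

theorem IsCharacter.add {G : Type} [Group G] {f₁ f₂ : G → ℂ} (h₁ : IsCharacter f₁)
    (h₂ : IsCharacter f₂) : IsCharacter (f₁ + f₂) := by
  obtain ⟨W₁, h₁⟩ := h₁
  obtain ⟨W₂, h₂⟩ := h₂
  refine ⟨FDRep.of (Representation.prod W₁.ρ W₂.ρ), fun g => ?_⟩
  rw [Pi.add_apply, h₁, h₂]
  exact (LinearMap.trace_prodMap' _ _).symm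

theorem IsCharacter.sum {G : Type} {ι : Type*} [Group G] (s : Finset ι) (f : ι → G → ℂ)
    (h : ∀ i ∈ s, IsCharacter (f i)) : IsCharacter (∑ i ∈ s, f i) :=
  Finset.sum_induction f IsCharacter (fun _ _ => IsCharacter.add) IsCharacter.zero h

variable {G : Type} [Group G] [Fintype G] {W : Type} [AddCommGroup W] [Module ℂ W]
  {P : Subgroup G}

/-- The representation of `P` on `G → W` whose invariants are the induced module. -/
noncomputable def Representation.twistedTranslation (σ : Representation ℂ P W) :
    Representation ℂ P (G → W) where
  toFun p := (σ p).compLeft G ∘ₗ LinearMap.funLeft ℂ W (fun t => (p : G)⁻¹ * t)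
  map_one' := by
    ext
    simp [LinearMap.funLeft]
  map_mul' p q := by
    refine LinearMap.ext fun f => funext fun t => ?_
    simp [LinearMap.funLeft, mul_assoc]

theorem Representation.twistedTranslation_apply (σ : Representation ℂ P W) (p : P) (f : G → W)
    (t : G) : σ.twistedTranslation p f t = σ p (f ((p : G)⁻¹ * t)) := rfl

/-- Right translation on `P`-equivariant functions. -/
noncomputable def Representation.inducedRep (σ : Representation ℂ P W) :
    Representation ℂ G (invariants σ.twistedTranslation) where
  toFun g := (LinearMap.funLeft ℂ W (fun t => t * g)).restrict (fun f hf p => by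
    refine funext fun t => ?_
    have := congrFun (hf p) (t * g)
    rw [twistedTranslation_apply] at this ⊢
    simpa [LinearMap.funLeft, mul_assoc] using this)
  map_one' := by
    refine LinearMap.ext fun f => Subtype.ext (funext fun t => ?_)
    simp [LinearMap.funLeft]
  map_mul' g g' := by
    refine LinearMap.ext fun f => Subtype.ext (funext fun t => ?_)
    simp [LinearMap.funLeft, mul_assoc]

theorem Representation.character_inducedRep [FiniteDimensional ℂ W] (σ : Representation ℂ P W)
    (g : G) : σ.inducedRep.character g = (Nat.card P : ℂ)⁻¹ *
      ∑ s : G, if h : s * g * s⁻¹ ∈ P then σ.character ⟨s * g * s⁻¹, h⟩ else 0 := by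
  have hne : (Fintype.card P : ℂ) ≠ 0 := Nat.cast_ne_zero.mpr Fintype.card_ne_zero
  have := invertibleOfNonzero hne
  set A := σ.twistedTranslation with hA
  let R := LinearMap.funLeft ℂ W (fun t => t * g)
  let e : (G → W) →ₗ[ℂ] invariants A :=
    A.averageMap.codRestrict _ A.averageMap_invariant
  have h1 : σ.inducedRep g = e ∘ₗ R ∘ₗ (invariants A).subtype := by
    refine LinearMap.ext fun f => Subtype.ext ?_
    exact (A.averageMap_id _ (σ.inducedRep g f).2).symm
  have h2 : σ.inducedRep.character g = LinearMap.trace ℂ _ (R ∘ₗ A.averageMap) := by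
    rw [character, h1, LinearMap.trace_comp_comm']
    rfl
  have h3 : A.averageMap = (Nat.card P : ℂ)⁻¹ • ∑ p, A p := by
    rw [averageMap, GroupAlgebra.average, map_smul, map_sum]
    simp
  rw [h2, h3, LinearMap.comp_smul, map_smul, smul_eq_mul]
  congr 1
  have h4 : R ∘ₗ ∑ p, A p = ∑ p, R ∘ₗ A p := map_sum (LinearMap.compRight ℂ R) _ _
  rw [h4, map_sum]
  simp_rw [LinearMap.trace_pi_eq_sum]
  rw [Finset.sum_comm]
  refine Finset.sum_congr rfl fun s _ => ?_
  have h5 : ∀ p : P, LinearMap.proj s ∘ₗ (R ∘ₗ A p) ∘ₗ LinearMap.single ℂ (fun _ => W) s =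
      if (p : G) = s * g * s⁻¹ then σ p else 0 := by
    intro p
    refine LinearMap.ext fun w => ?_
    have hiff : (p : G) = s * g * s⁻¹ ↔ (p : G)⁻¹ * (s * g) = s := by
      rw [eq_mul_inv_iff_mul_eq, inv_mul_eq_iff_eq_mul, eq_comm]
    simp only [LinearMap.comp_apply, LinearMap.proj_apply, LinearMap.coe_single, R,
      LinearMap.funLeft_apply, A, twistedTranslation_apply]
    by_cases hp : (p : G) = s * g * s⁻¹
    · rw [if_pos hp, hiff.mp hp, Pi.single_eq_same]
    · rw [if_neg hp, Pi.single_eq_of_ne (fun h => hp (hiff.mpr h)), map_zero,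
        LinearMap.zero_apply]
  simp_rw [h5]
  by_cases hs : s * g * s⁻¹ ∈ P
  · rw [dif_pos hs, Finset.sum_eq_single ⟨_, hs⟩]
    · simp [character]
    · intro p _ hp
      rw [if_neg (fun h => hp (Subtype.ext h)), map_zero]
    · simp
  · rw [dif_neg hs]
    refine Finset.sum_eq_zero fun p _ => ?_
    rw [if_neg (fun h : (p : G) = s * g * s⁻¹ => hs (h ▸ p.2)), map_zero]

/-- The function induced from a character of a subgroup is a character. -/
theorem isCharacter_induced [FiniteDimensional ℂ W] (σ : Representation ℂ P W) :
    IsCharacter fun g : G => (Nat.card P : ℂ)⁻¹ *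
      ∑ s : G, if h : s * g * s⁻¹ ∈ P then σ.character ⟨s * g * s⁻¹, h⟩ else 0 :=
  ⟨FDRep.of σ.inducedRep, fun g => (σ.character_inducedRep g).symm⟩

end InducedCharacters

section IrreducibleOnSubset

variable {L : Type} [Group L]

/-- `ψ` is an irreducible character of the subgroup with carrier `H`, extended by zero. -/
def IsIrrOn (H : Set L) (ψ : L → ℂ) : Prop :=
  (∀ h : L, h ∉ H → ψ h = 0) ∧
    ∃ H₀ : Subgroup L, (H₀ : Set L) = H ∧
      ∃ W : FDRep ℂ ↥H₀, CategoryTheory.Simple W ∧ ∀ h : ↥H₀, ψ ↑h = W.character h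

/-- `θ` is the sum over an `S`-orbit of irreducible characters of `H`. -/
def IsOrbitIrrOn (H S : Set L) (θ : L → ℂ) : Prop :=
  ∃ Sfin : Finset (L → ℂ),
    (∀ ψ ∈ Sfin, IsIrrOn H ψ) ∧
    (∃ ψ₀ ∈ Sfin, ∀ ψ : L → ℂ,
      ψ ∈ Sfin ↔ ∃ r ∈ S, ∀ h : L, ψ h = ψ₀ (r * h * r⁻¹)) ∧
    ∀ h : L, θ h = ∑ ψ ∈ Sfin, ψ h

theorem IsIrrOn.eq_zero {H : Set L} {ψ : L → ℂ} (h : IsIrrOn H ψ) {x : L} (hx : x ∉ H) :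
    ψ x = 0 := h.1 x hx

theorem IsOrbitIrrOn.eq_zero {H S : Set L} {θ : L → ℂ} (h : IsOrbitIrrOn H S θ) {x : L}
    (hx : x ∉ H) : θ x = 0 := by
  obtain ⟨A, hA, -, hθ⟩ := h
  rw [hθ]
  exact Finset.sum_eq_zero fun ψ hψ => (hA ψ hψ).eq_zero hx

variable [Fintype L]

theorem sum_subgroup_eq_sum (H : Subgroup L) (F : L → ℂ) (hF : ∀ h ∉ H, F h = 0) :
    ∑ h : H, F h = ∑ h, F h := by
  rw [← Finset.sum_subset (Finset.subset_univ (Finset.univ.filter (· ∈ H)))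
    (fun h _ hh => hF h (by simpa using hh))]
  exact (Finset.sum_subtype _ (by simp) F).symm

theorem IsIrrOn.orthogonal {H : Set L} {ψ ψ' : L → ℂ} (h : IsIrrOn H ψ) (h' : IsIrrOn H ψ')
    (hne : ψ ≠ ψ') : ∑ x, ψ x * starRingEnd ℂ (ψ' x) = 0 := by
  obtain ⟨h0, H₀, rfl, W, hW, hψ⟩ := h
  obtain ⟨h0', H₁, hH, W', hW', hψ'⟩ := h'
  obtain rfl : H₁ = H₀ := SetLike.coe_injective hH
  have hc : (Nat.card H₁ : ℂ) ≠ 0 := Nat.cast_ne_zero.mpr Nat.card_pos.ne'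
  have := invertibleOfNonzero hc
  have ho := FDRep.char_orthonormal W W'
  rw [if_neg, mul_eq_zero] at ho
  · rw [← sum_subgroup_eq_sum H₁ _ fun x hx => by rw [h0 x hx, zero_mul]]
    rw [← ho.resolve_left (inv_ne_zero hc)]
    refine Finset.sum_congr rfl fun x _ => ?_
    rw [hψ, hψ']
    congr 1
    exact (Representation.character_inv_eq_conj W'.ρ x).symm
  · rintro ⟨i⟩
    refine hne (funext fun x => ?_)
    by_cases hx : x ∈ H₁
    · exact (hψ ⟨x, hx⟩).trans ((congrFun (FDRep.char_iso i) _).trans (hψ' ⟨x, hx⟩).symm)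
    · rw [h0 x hx, h0' x hx]

theorem IsIrrOn.comp {H H' : Set L} {ψ : L → ℂ} (h : IsIrrOn H ψ) (φ : MulAut L)
    (hφ : ∀ x, x ∈ H' ↔ φ x ∈ H) : IsIrrOn H' (ψ ∘ φ) := by
  obtain ⟨h0, H₀, rfl, W, hW, hψ⟩ := h
  refine ⟨fun x hx => h0 _ fun h => hx ((hφ x).mpr h), H₀.comap φ.toMonoidHom,
    Set.ext fun x => (hφ x).symm, ?_⟩
  let e : H₀.comap φ.toMonoidHom ≃* H₀ :=
    { toFun := fun x => ⟨φ x, x.2⟩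
      invFun := fun x => ⟨φ.symm x, by
        change φ (φ.symm x) ∈ H₀
        rw [MulEquiv.apply_symm_apply]
        exact x.2⟩
      left_inv := fun x => Subtype.ext (φ.symm_apply_apply x)
      right_inv := fun x => Subtype.ext (φ.apply_symm_apply x)
      map_mul' := fun x y => Subtype.ext (map_mul φ _ _) }
  have hchar : ∀ x, (FDRep.of (W.ρ.comp e.toMonoidHom)).character x = W.character (e x) :=
    fun x => rfl
  refine ⟨FDRep.of (W.ρ.comp e.toMonoidHom), ?_, fun x => hψ (e x)⟩
  rw [FDRep.simple_iff_char_is_norm_one] at hW ⊢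
  rw [Nat.card_congr e.toEquiv, ← hW]
  simp_rw [hchar, map_inv]
  exact Equiv.sum_comp e.toEquiv fun x => W.character x * W.character x⁻¹

theorem IsIrrOn.exists_apply_one {H : Set L} {ψ : L → ℂ} (h : IsIrrOn H ψ) :
    ∃ n : ℕ, 0 < n ∧ ψ 1 = n := by
  obtain ⟨-, H₀, rfl, W, hW, hψ⟩ := h
  refine ⟨Module.finrank ℂ W, ?_, (hψ 1).trans W.char_one⟩
  by_contra hn
  have hs : Subsingleton W := Module.finrank_zero_iff (R := ℂ).mp (Nat.eq_zero_of_not_pos hn)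
  rw [FDRep.simple_iff_char_is_norm_one] at hW
  have hz : ∀ x, W.character x = 0 := fun x =>
    (congrArg (LinearMap.trace ℂ W) (Subsingleton.elim (W.ρ x) 0)).trans (map_zero _)
  simp only [hz, mul_zero, Finset.sum_const_zero] at hW
  exact Nat.cast_ne_zero.mpr Nat.card_pos.ne' hW.symm

theorem IsOrbitIrrOn.apply_one_ne_zero {H S : Set L} {θ : L → ℂ} (h : IsOrbitIrrOn H S θ) :
    θ 1 ≠ 0 := by
  obtain ⟨A, hA, ⟨ψ₀, h₀, -⟩, hθ⟩ := h
  have : ∃ n : ℕ, 0 < n ∧ ∑ ψ ∈ A, ψ 1 = n := by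
    refine Finset.sum_induction_nonempty (fun ψ : L → ℂ => ψ 1) (fun z => ∃ n : ℕ, 0 < n ∧ z = n)
      ?_ ⟨ψ₀, h₀⟩ fun ψ hψ => (hA ψ hψ).exists_apply_one
    rintro _ _ ⟨m, hm, rfl⟩ ⟨n, hn, rfl⟩
    exact ⟨m + n, by omega, by push_cast; rfl⟩
  obtain ⟨n, hn, h⟩ := this
  rw [hθ, h]
  exact Nat.cast_ne_zero.mpr hn.ne'

theorem IsOrbitIrrOn.orthogonal {H : Set L} {S : Subgroup L} {θ θ' : L → ℂ}
    (h : IsOrbitIrrOn H S θ) (h' : IsOrbitIrrOn H S θ') (hne : θ ≠ θ') :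
    ∑ x, θ x * starRingEnd ℂ (θ' x) = 0 := by
  obtain ⟨A, hA, ⟨ψ₀, h₀, hS⟩, hθ⟩ := h
  obtain ⟨A', hA', ⟨ψ₀', h₀', hS'⟩, hθ'⟩ := h'
  have hdisj : ∀ ψ ∈ A, ∀ ψ' ∈ A', ψ ≠ ψ' := by
    rintro ψ hψ _ hψ' rfl
    obtain ⟨r, hr, hψr⟩ := (hS ψ).mp hψ
    obtain ⟨r', hr', hψr'⟩ := (hS' ψ).mp hψ'
    refine hne (funext fun x => ?_)
    rw [hθ, hθ']
    congr 1
    ext φ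
    rw [hS, hS']
    constructor
    · rintro ⟨s, hs, hφ⟩
      refine ⟨r' * r⁻¹ * s, S.mul_mem (S.mul_mem hr' (S.inv_mem hr)) hs, fun x => ?_⟩
      have h1 := hψr (r⁻¹ * s * x * s⁻¹ * r)
      rw [hψr'] at h1
      rw [hφ]
      refine Eq.trans ?_ (h1.symm.trans ?_) <;> congr 1 <;> group
    · rintro ⟨s, hs, hφ⟩
      refine ⟨r * r'⁻¹ * s, S.mul_mem (S.mul_mem hr (S.inv_mem hr')) hs, fun x => ?_⟩
      have h1 := hψr (r'⁻¹ * s * x * s⁻¹ * r')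
      rw [hψr'] at h1
      rw [hφ]
      refine Eq.trans ?_ (h1.trans ?_) <;> congr 1 <;> group
  simp_rw [hθ, hθ', map_sum, Finset.sum_mul_sum]
  rw [Finset.sum_comm]
  refine Finset.sum_eq_zero fun ψ hψ => ?_
  rw [Finset.sum_comm]
  exact Finset.sum_eq_zero fun ψ' hψ' =>
    (hA ψ hψ).orthogonal (hA' ψ' hψ') (hdisj ψ hψ ψ' hψ')

theorem IsOrbitIrrOn.comp {H H' S S' : Set L} {θ : L → ℂ} (h : IsOrbitIrrOn H S θ)
    (φ : MulAut L) (hH : ∀ x, x ∈ H' ↔ φ x ∈ H) (hS : ∀ x, x ∈ S' ↔ φ x ∈ S) :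
    IsOrbitIrrOn H' S' (θ ∘ φ) := by
  obtain ⟨A, hA, ⟨ψ₀, h₀, hAS⟩, hθ⟩ := h
  have hinj : Function.Injective fun ψ : L → ℂ => ψ ∘ φ := fun ψ ψ' he =>
    funext fun x => by simpa using congrFun he (φ.symm x)
  refine ⟨A.image fun ψ => ψ ∘ φ, ?_, ⟨ψ₀ ∘ φ, Finset.mem_image_of_mem _ h₀, fun ψ => ?_⟩, ?_⟩
  · intro ψ hψ
    obtain ⟨φ₀, hφ₀, rfl⟩ := Finset.mem_image.mp hψ
    exact (hA φ₀ hφ₀).comp φ hH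
  · rw [Finset.mem_image]
    constructor
    · rintro ⟨ψ, hψ, rfl⟩
      obtain ⟨r, hr, he⟩ := (hAS ψ).mp hψ
      refine ⟨φ.symm r, (hS _).mpr (by simpa using hr), fun x => ?_⟩
      simp [he]
    · rintro ⟨r, hr, he⟩
      refine ⟨ψ ∘ φ.symm, (hAS _).mpr ⟨φ r, (hS r).mp hr, fun x => ?_⟩, ?_⟩
      · simp [he]
      · ext x
        simp
  · intro x
    rw [Finset.sum_image fun _ _ _ _ he => hinj he]
    exact hθ (φ x)

/-- An `S`-invariant function on `H` orthogonal to all `S`-irreducible characters vanishes. -/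
theorem eq_zero_of_forall_isOrbitIrrOn {H S : Subgroup L} (hHS : H ≤ S)
    (hnorm : ∀ s ∈ S, ∀ x, x ∈ H ↔ s * x * s⁻¹ ∈ H) (f : L → ℂ) (hf0 : ∀ x ∉ H, f x = 0)
    (hf : ∀ s ∈ S, ∀ x, f (s * x * s⁻¹) = f x)
    (h0 : ∀ θ, IsOrbitIrrOn (H : Set L) S θ → ∑ x, f x * θ x = 0) : f = 0 := by
  have key : (fun x : H => f x) = 0 := by
    refine FDRep.eq_zero_of_forall_simple _ (fun g x => hf g (hHS g.2) x) fun W hW => ?_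
    let ψ : L → ℂ := fun x => if hx : x ∈ H then W.character ⟨x, hx⟩ else 0
    have hψ : IsIrrOn (H : Set L) ψ :=
      ⟨fun x hx => dif_neg hx, H, rfl, W, hW, fun x => dif_pos x.2⟩
    let A : Finset (L → ℂ) :=
      (Finset.univ.filter (· ∈ S)).image fun s x => ψ (s * x * s⁻¹)
    have hmem : ∀ φ, φ ∈ A ↔ ∃ s ∈ S, ∀ x, φ x = ψ (s * x * s⁻¹) := by
      intro φ
      simp only [A, Finset.mem_image, Finset.mem_filter, Finset.mem_univ, true_and]
      exact exists_congr fun s => and_congr_right fun _ => by rw [eq_comm, funext_iff]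
    have hψA : ψ ∈ A := (hmem ψ).mpr ⟨1, S.one_mem, fun x => by simp⟩
    have hθ : IsOrbitIrrOn (H : Set L) S fun x => ∑ φ ∈ A, φ x := by
      refine ⟨A, fun φ hφ => ?_, ⟨ψ, hψA, hmem⟩, fun _ => rfl⟩
      obtain ⟨s, hs, he⟩ := (hmem φ).mp hφ
      have := hψ.comp (MulAut.conj s) (hnorm s hs)
      rwa [show φ = ψ ∘ MulAut.conj s from funext he]
    have hz := h0 _ hθ
    simp_rw [Finset.mul_sum] at hz
    rw [Finset.sum_comm] at hz
    have hconst : ∀ φ ∈ A, ∑ x, f x * φ x = ∑ x, f x * ψ x := by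
      intro φ hφ
      obtain ⟨s, hs, he⟩ := (hmem φ).mp hφ
      refine Fintype.sum_equiv (MulAut.conj s).toEquiv _ _ fun x => ?_
      rw [he]
      simp [hf s hs]
    rw [Finset.sum_congr rfl hconst, Finset.sum_const, nsmul_eq_mul, mul_eq_zero] at hz
    have hz' := hz.resolve_left (Nat.cast_ne_zero.mpr (Finset.card_pos.mpr ⟨ψ, hψA⟩).ne')
    rw [← sum_subgroup_eq_sum H _ fun x hx => by rw [hf0 x hx, zero_mul]] at hz'
    rw [← hz']
    exact Finset.sum_congr rfl fun x _ => by rw [show ψ x = W.character x from dif_pos x.2]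
  ext x
  by_cases hx : x ∈ H
  · exact congrFun key ⟨x, hx⟩
  · exact hf0 x hx

end IrreducibleOnSubset

section OperatorFamilies

/-- A finite family `T` of operators on `J` that behaves like the operators of a group action,
together with an action `c` of `L` on `J` normalizing it. -/
structure OperatorFamily (F J L ι : Type) [Field F] [AddCommGroup J] [Module F J] [Group L] where
  T : ι → Module.End F J
  c : L →* Module.End F J
  exists_one : ∃ i, T i = 1
  exists_mul_left : ∀ i, ∃ e : Equiv.Perm ι, ∀ j, T (e j) = T i * T j
  exists_mul_right : ∀ i, ∃ e : Equiv.Perm ι, ∀ j, T (e j) = T j * T i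
  exists_conj : ∀ a, ∃ e : Equiv.Perm ι, ∀ j, T (e j) * c a = c a * T j

namespace OperatorFamily

open Module

variable {F J L ι : Type} [Field F] [AddCommGroup J] [Module F J] [Group L]
  (D : OperatorFamily F J L ι)

/-- The orbit of `l` in the dual space. -/
def orb (l : Dual F J) : Set (Dual F J) := {μ | ∃ i, μ = l ∘ₗ D.T i}

/-- The coadjoint action of `L`. -/
def Ad (r : L) (μ : Dual F J) : Dual F J := μ ∘ₗ D.c r⁻¹

theorem c_inv_apply_apply (r : L) (x : J) : D.c r⁻¹ (D.c r x) = x := by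
  rw [← Module.End.mul_apply, ← map_mul, inv_mul_cancel, map_one, Module.End.one_apply]

theorem c_apply_inv_apply (r : L) (x : J) : D.c r (D.c r⁻¹ x) = x := by
  rw [← Module.End.mul_apply, ← map_mul, mul_inv_cancel, map_one, Module.End.one_apply]

theorem c_mul_apply (r s : L) (x : J) : D.c (r * s) x = D.c r (D.c s x) := by
  rw [map_mul, Module.End.mul_apply]

theorem Ad_apply (r : L) (μ : Dual F J) (x : J) : D.Ad r μ x = μ (D.c r⁻¹ x) := rfl

theorem Ad_one (μ : Dual F J) : D.Ad 1 μ = μ := by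
  ext x
  simp [Ad_apply]

theorem Ad_mul (r s : L) (μ : Dual F J) : D.Ad (r * s) μ = D.Ad r (D.Ad s μ) := by
  ext x
  simp [Ad_apply]

theorem Ad_inv_Ad (r : L) (μ : Dual F J) : D.Ad r⁻¹ (D.Ad r μ) = μ := by
  rw [← Ad_mul, inv_mul_cancel, Ad_one]

theorem Ad_Ad_inv (r : L) (μ : Dual F J) : D.Ad r (D.Ad r⁻¹ μ) = μ := by
  rw [← Ad_mul, mul_inv_cancel, Ad_one]

theorem Ad_eq_iff {r : L} {μ ν : Dual F J} : D.Ad r μ = ν ↔ μ = D.Ad r⁻¹ ν :=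
  ⟨fun h => by rw [← h, Ad_inv_Ad], fun h => by rw [h, Ad_Ad_inv]⟩

theorem mem_orb_self (l : Dual F J) : l ∈ D.orb l := by
  obtain ⟨i, hi⟩ := D.exists_one
  exact ⟨i, by rw [hi]; rfl⟩

theorem exists_rightInverse (i : ι) : ∃ j, D.T i * D.T j = 1 := by
  obtain ⟨i₀, h₀⟩ := D.exists_one
  obtain ⟨e, he⟩ := D.exists_mul_left i
  exact ⟨e.symm i₀, by rw [← he, Equiv.apply_symm_apply, h₀]⟩

theorem orb_eq_of_mem {l μ : Dual F J} (h : μ ∈ D.orb l) : D.orb μ = D.orb l := by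
  obtain ⟨i, rfl⟩ := h
  obtain ⟨e, he⟩ := D.exists_mul_left i
  ext ν
  constructor
  · rintro ⟨j, rfl⟩
    exact ⟨e j, by rw [he]; rfl⟩
  · rintro ⟨j, rfl⟩
    refine ⟨e.symm j, ?_⟩
    have := he (e.symm j)
    rw [Equiv.apply_symm_apply] at this
    rw [this]
    rfl

theorem Ad_mem_orb_Ad {l μ : Dual F J} (r : L) (h : μ ∈ D.orb l) :
    D.Ad r μ ∈ D.orb (D.Ad r l) := by
  obtain ⟨i, rfl⟩ := h
  obtain ⟨e, he⟩ := D.exists_conj r⁻¹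
  refine ⟨e.symm i, LinearMap.ext fun x => ?_⟩
  have := LinearMap.congr_fun (he (e.symm i)) x
  rw [Equiv.apply_symm_apply] at this
  exact congrArg l this

theorem Ad_mem_orb_Ad_iff {l μ : Dual F J} (r : L) :
    D.Ad r μ ∈ D.orb (D.Ad r l) ↔ μ ∈ D.orb l :=
  ⟨fun h => by simpa only [Ad_inv_Ad] using D.Ad_mem_orb_Ad r⁻¹ h, D.Ad_mem_orb_Ad r⟩

/-- The elements of `L` fixing the orbit of `l` pointwise. -/
def fixer (l : Dual F J) : Subgroup L where
  carrier := {r | ∀ μ ∈ D.orb l, D.Ad r μ = μ}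
  one_mem' := fun μ _ => D.Ad_one μ
  mul_mem' := fun {a b} ha hb μ hμ => by rw [Ad_mul, hb μ hμ, ha μ hμ]
  inv_mem' := fun {a} ha μ hμ => by rw [← D.Ad_eq_iff.mp (ha μ hμ)]

/-- The elements of `L` preserving the orbit of `l`. -/
def stab (l : Dual F J) : Subgroup L where
  carrier := {r | ∀ μ, μ ∈ D.orb l ↔ D.Ad r μ ∈ D.orb l}
  one_mem' := fun μ => by rw [Ad_one]
  mul_mem' := fun {a b} ha hb μ => by rw [Ad_mul, ← ha, ← hb]
  inv_mem' := fun {a} ha μ => by rw [ha (D.Ad a⁻¹ μ), Ad_Ad_inv]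

theorem mem_fixer {l : Dual F J} {r : L} : r ∈ D.fixer l ↔ ∀ μ ∈ D.orb l, D.Ad r μ = μ :=
  Iff.rfl

theorem mem_stab {l : Dual F J} {r : L} :
    r ∈ D.stab l ↔ ∀ μ, μ ∈ D.orb l ↔ D.Ad r μ ∈ D.orb l := Iff.rfl

theorem fixer_le_stab (l : Dual F J) : D.fixer l ≤ D.stab l := by
  intro r hr μ
  constructor
  · intro h
    rwa [hr μ h]
  · intro h
    rw [← D.Ad_inv_Ad r μ, (D.fixer l).inv_mem hr _ h]
    exact h

theorem orb_Ad_eq {l l' : Dual F J} {r : L} (h : D.Ad r l ∈ D.orb l') (μ : Dual F J) :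
    D.Ad r μ ∈ D.orb l' ↔ μ ∈ D.orb l := by
  rw [← D.orb_eq_of_mem h, Ad_mem_orb_Ad_iff]

theorem mem_orb_iff_of_Ad {l l' : Dual F J} {r : L} (h : D.Ad r l ∈ D.orb l') (μ : Dual F J) :
    μ ∈ D.orb l' ↔ D.Ad r⁻¹ μ ∈ D.orb l := by
  rw [← D.orb_Ad_eq h, Ad_Ad_inv]

theorem mem_fixer_iff_of_Ad {l l' : Dual F J} {r : L} (h : D.Ad r l ∈ D.orb l') (x : L) :
    x ∈ D.fixer l' ↔ r⁻¹ * x * r ∈ D.fixer l := by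
  simp only [mem_fixer]
  constructor
  · intro hx μ hμ
    rw [Ad_mul, Ad_mul, hx _ ((D.orb_Ad_eq h μ).mpr hμ), Ad_inv_Ad]
  · intro hx μ hμ
    have := hx _ ((D.mem_orb_iff_of_Ad h μ).mp hμ)
    rwa [Ad_mul, Ad_mul, Ad_Ad_inv, Ad_eq_iff, inv_inv, Ad_Ad_inv] at this

theorem mem_stab_iff_of_Ad {l l' : Dual F J} {r : L} (h : D.Ad r l ∈ D.orb l') (x : L) :
    x ∈ D.stab l' ↔ r⁻¹ * x * r ∈ D.stab l := by
  simp only [mem_stab]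
  constructor
  · intro hx μ
    rw [Ad_mul, Ad_mul, ← D.mem_orb_iff_of_Ad h, ← hx, D.orb_Ad_eq h]
  · intro hx μ
    rw [D.mem_orb_iff_of_Ad h, D.mem_orb_iff_of_Ad h, hx, Ad_mul, Ad_mul, Ad_Ad_inv]

theorem Ad_mem_orb_of_mem_stab {l : Dual F J} {s : L} (hs : s ∈ D.stab l) :
    D.Ad s l ∈ D.orb l := (hs l).mp (D.mem_orb_self l)

theorem mem_fixer_iff_conj {l : Dual F J} {s : L} (hs : s ∈ D.stab l) (x : L) :
    x ∈ D.fixer l ↔ s * x * s⁻¹ ∈ D.fixer l := by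
  have := D.mem_fixer_iff_of_Ad (D.Ad_mem_orb_of_mem_stab ((D.stab l).inv_mem hs)) x
  rwa [inv_inv] at this

theorem fixer_eq_of_mem {l μ : Dual F J} (h : μ ∈ D.orb l) : D.fixer μ = D.fixer l := by
  ext x
  rw [mem_fixer, mem_fixer, D.orb_eq_of_mem h]

theorem stab_eq_of_mem {l μ : Dual F J} (h : μ ∈ D.orb l) : D.stab μ = D.stab l := by
  ext x
  rw [mem_stab, mem_stab, D.orb_eq_of_mem h]

/-- The common kernel of the functionals whose orbit is fixed pointwise by `h`. -/
def fixedKernel (h : L) : Set J := {x | ∀ μ, h ∈ D.fixer μ → μ x = 0}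

/-- The functionals whose orbit is fixed pointwise by `h`. -/
def fixedDual (h : L) : Submodule F (Dual F J) where
  carrier := {μ | h ∈ D.fixer μ}
  add_mem' := by
    rintro μ ν hμ hν _ ⟨i, rfl⟩
    have h1 := hμ _ ⟨i, rfl⟩
    have h2 := hν _ ⟨i, rfl⟩
    ext x
    exact congrArg₂ (· + ·) (LinearMap.congr_fun h1 x) (LinearMap.congr_fun h2 x)
  zero_mem' := by
    rintro _ ⟨i, rfl⟩
    rfl
  smul_mem' := by
    rintro t μ hμ _ ⟨i, rfl⟩
    have h1 := hμ _ ⟨i, rfl⟩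
    ext x
    exact congrArg (t • ·) (LinearMap.congr_fun h1 x)

theorem c_mem_fixedKernel {h : L} {x : J} (hx : x ∈ D.fixedKernel h) (r : L) :
    D.c r x ∈ D.fixedKernel (r * h * r⁻¹) := by
  intro μ hμ
  refine hx (D.Ad r⁻¹ μ) ?_ |>.symm.trans ?_ |>.symm
  · have := D.mem_fixer_iff_of_Ad (r := r) (l := D.Ad r⁻¹ μ) (l' := μ)
      (by rw [Ad_Ad_inv]; exact D.mem_orb_self μ) (r * h * r⁻¹)
    have h2 := this.mp hμ
    rwa [show r⁻¹ * (r * h * r⁻¹) * r = h by group] at h2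
  · rw [Ad_apply, inv_inv]

theorem exists_mem_fixedKernel [Finite J] {h : L} {μ : Dual F J} (hμ : h ∉ D.fixer μ) :
    ∃ x ∈ D.fixedKernel h, μ x ≠ 0 := by
  by_contra! hx
  have : μ ∈ (D.fixedDual h).dualCoannihilator.dualAnnihilator := by
    rw [Submodule.mem_dualAnnihilator]
    intro x hx'
    rw [Submodule.mem_dualCoannihilator] at hx'
    exact hx x hx'
  rw [Subspace.dualCoannihilator_dualAnnihilator_eq] at this
  exact hμ this

theorem smul_mem_fixedKernel {h : L} {x : J} (hx : x ∈ D.fixedKernel h) (t : F) :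
    t • x ∈ D.fixedKernel h := fun μ hμ => by rw [map_smul, hx μ hμ, smul_zero]

theorem zero_mem_fixedKernel (h : L) : (0 : J) ∈ D.fixedKernel h := fun μ _ => map_zero μ

variable [Fintype ι] (ε : AddChar F ℂ)

/-- The exponential sum over the orbit of `l`, counted with multiplicity. -/
noncomputable def orbSum (l : Dual F J) (x : J) : ℂ := ∑ i, ε (l (D.T i x))

theorem orbSum_eq_of_mem {l μ : Dual F J} (h : μ ∈ D.orb l) :
    D.orbSum ε μ = D.orbSum ε l := by
  obtain ⟨i, rfl⟩ := h
  obtain ⟨e, he⟩ := D.exists_mul_left i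
  ext x
  refine Fintype.sum_equiv e _ _ fun j => ?_
  rw [he]
  rfl

theorem orbSum_T (l : Dual F J) (i : ι) (x : J) :
    D.orbSum ε l (D.T i x) = D.orbSum ε l x := by
  obtain ⟨e, he⟩ := D.exists_mul_right i
  refine Fintype.sum_equiv e _ _ fun j => ?_
  rw [he]
  rfl

theorem orbSum_Ad (l : Dual F J) (r : L) (x : J) :
    D.orbSum ε (D.Ad r l) x = D.orbSum ε l (D.c r⁻¹ x) := by
  obtain ⟨e, he⟩ := D.exists_conj r⁻¹
  refine Fintype.sum_equiv e _ _ fun j => ?_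
  rw [Ad_apply, ← Module.End.mul_apply, ← he]
  rfl

variable [Fintype L]

/-- The (unnormalized) supercharacter, as a function on pairs `(h, x)`. -/
noncomputable def superSum (θ : L → ℂ) (l : Dual F J) (h : L) (x : J) : ℂ :=
  ∑ a, θ (a * h * a⁻¹) * D.orbSum ε l (D.c a x)

theorem superSum_conj (θ : L → ℂ) (l : Dual F J) (r h : L) (x : J) :
    D.superSum ε θ l (r * h * r⁻¹) (D.c r x) = D.superSum ε θ l h x := by
  refine Fintype.sum_equiv (Equiv.mulRight r) _ _ fun a => ?_
  simp only [Equiv.coe_mulRight, c_mul_apply, mul_inv_rev, mul_assoc]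

theorem superSum_eq_of_Ad {θ θ' : L → ℂ} {l l' : Dual F J} {r : L}
    (h : D.Ad r l ∈ D.orb l') (hθ : ∀ x, θ' x = θ (r⁻¹ * x * r)) :
    D.superSum ε θ' l' = D.superSum ε θ l := by
  ext g x
  refine Fintype.sum_equiv (Equiv.mulLeft r⁻¹) _ _ fun a => ?_
  rw [hθ, ← D.orbSum_eq_of_mem ε h, orbSum_Ad]
  simp only [Equiv.coe_mulLeft, c_mul_apply, mul_inv_rev, mul_assoc, inv_inv]

theorem superSum_add_fixedKernel {θ : L → ℂ} {l : Dual F J} (hθ : ∀ x ∉ D.fixer l, θ x = 0)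
    (h : L) (i : ι) (x : J) {y : J} (hy : y ∈ D.fixedKernel h) :
    D.superSum ε θ l h (D.T i x + y) = D.superSum ε θ l h x := by
  refine Finset.sum_congr rfl fun a _ => ?_
  by_cases ha : a * h * a⁻¹ ∈ D.fixer l
  · congr 1
    have h1 : D.orbSum ε l (D.c a (D.T i x + y)) = D.orbSum ε l (D.c a (D.T i x)) := by
      refine Finset.sum_congr rfl fun k _ => ?_
      rw [map_add, map_add, map_add]
      have := D.c_mem_fixedKernel hy a (l ∘ₗ D.T k)
        (by rw [D.fixer_eq_of_mem ⟨k, rfl⟩]; exact ha)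
      rw [show l (D.T k (D.c a y)) = 0 from this, add_zero]
    obtain ⟨e, he⟩ := D.exists_conj a
    rw [h1, ← Module.End.mul_apply, ← he, Module.End.mul_apply, orbSum_T]
  · rw [hθ _ ha, zero_mul, zero_mul]

theorem superSum_one_zero (θ : L → ℂ) (l : Dual F J) :
    D.superSum ε θ l 1 0 = Fintype.card L * (θ 1 * Fintype.card ι) := by
  simp [superSum, orbSum]

variable [Finite F] [Fintype J]

theorem conj_addChar_apply (ε : AddChar F ℂ) (t : F) : starRingEnd ℂ (ε t) = ε (-t) := by
  rw [AddChar.map_neg_eq_conj]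

variable {ε} (hε : ε ≠ 1)
include hε

omit [Finite F] in
theorem exists_addChar_ne_one : ∃ t, ε t ≠ 1 := by
  by_contra! h
  exact hε (DFunLike.ext _ _ fun t => h t)

theorem sum_addChar_mul_conj {μ ν : Dual F J} (h : μ ≠ ν) :
    ∑ x, ε (μ x) * starRingEnd ℂ (ε (ν x)) = 0 := by
  obtain ⟨x, hx⟩ : ∃ x, (μ - ν) x ≠ 0 := by
    by_contra! h'
    exact h (sub_eq_zero.mp (LinearMap.ext h'))
  obtain ⟨t, ht⟩ := exists_addChar_ne_one hε
  have hne : ε.compAddMonoidHom (μ - ν).toAddMonoidHom ≠ 1 := by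
    intro h1
    have := DFunLike.congr_fun h1 ((t / (μ - ν) x) • x)
    simp only [AddChar.compAddMonoidHom_apply, LinearMap.toAddMonoidHom_coe, map_smul,
      smul_eq_mul, AddChar.one_apply, div_mul_cancel₀ t hx] at this
    exact ht this
  rw [← AddChar.sum_eq_zero_of_ne_one hne]
  refine Finset.sum_congr rfl fun x _ => ?_
  rw [conj_addChar_apply, ← AddChar.map_add_eq_mul, ← sub_eq_add_neg]
  rfl

omit [Finite F] in
theorem sum_dual_addChar {y : J} (hy : y ≠ 0) [Fintype (Dual F J)] :
    ∑ μ : Dual F J, ε (μ y) = 0 := by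
  obtain ⟨μ, hμ⟩ : ∃ μ : Dual F J, μ y ≠ 0 := by
    by_contra! h'
    exact hy ((Module.forall_dual_apply_eq_zero_iff F y).mp h')
  obtain ⟨t, ht⟩ := exists_addChar_ne_one hε
  have hne : ε.compAddMonoidHom (Dual.eval F J y).toAddMonoidHom ≠ 1 := by
    intro h1
    have := DFunLike.congr_fun h1 ((t / μ y) • μ)
    simp only [AddChar.compAddMonoidHom_apply, LinearMap.toAddMonoidHom_coe, map_smul,
      smul_eq_mul, AddChar.one_apply, Dual.eval_apply, div_mul_cancel₀ t hμ] at this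
    exact ht this
  exact AddChar.sum_eq_zero_of_ne_one hne

omit [Fintype L] in
theorem sum_orbSum_mul_conj {l l' : Dual F J} {a b : L}
    (h : D.Ad (b * a⁻¹) l ∉ D.orb l') :
    ∑ x, D.orbSum ε l (D.c a x) * starRingEnd ℂ (D.orbSum ε l' (D.c b x)) = 0 := by
  simp_rw [orbSum, map_sum, Finset.sum_mul_sum]
  rw [Finset.sum_comm]
  refine Finset.sum_eq_zero fun i _ => ?_
  rw [Finset.sum_comm]
  refine Finset.sum_eq_zero fun j _ => ?_
  refine sum_addChar_mul_conj hε (μ := l ∘ₗ D.T i ∘ₗ D.c a) (ν := l' ∘ₗ D.T j ∘ₗ D.c b) ?_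
  intro he
  refine h ?_
  have h1 : D.Ad (b * a⁻¹) (l ∘ₗ D.T i) = l' ∘ₗ D.T j := by
    ext x
    have := LinearMap.congr_fun he (D.c b⁻¹ x)
    simp only [LinearMap.comp_apply, c_apply_inv_apply] at this
    rw [Ad_apply, mul_inv_rev, inv_inv, c_mul_apply]
    exact this
  have h2 : D.Ad (b * a⁻¹) (l ∘ₗ D.T i) ∈ D.orb (D.Ad (b * a⁻¹) l) :=
    D.Ad_mem_orb_Ad _ ⟨i, rfl⟩
  have h3 : D.Ad (b * a⁻¹) (l ∘ₗ D.T i) ∈ D.orb l' := ⟨j, h1⟩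
  rw [← D.orb_eq_of_mem h3, D.orb_eq_of_mem h2]
  exact D.mem_orb_self _

theorem superSum_orthogonal {θ θ' : L → ℂ} {l l' : Dual F J}
    (hθ : IsOrbitIrrOn (D.fixer l : Set L) (D.stab l) θ)
    (hθ' : IsOrbitIrrOn (D.fixer l' : Set L) (D.stab l') θ')
    (hne : ∀ r, D.Ad r l ∈ D.orb l' → ¬ ∀ x, θ' x = θ (r⁻¹ * x * r)) :
    ∑ h, ∑ x, D.superSum ε θ l h x * starRingEnd ℂ (D.superSum ε θ' l' h x) = 0 := by
  have hexp : ∀ h x, D.superSum ε θ l h x * starRingEnd ℂ (D.superSum ε θ' l' h x) =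
      ∑ a, ∑ b, (θ (a * h * a⁻¹) * starRingEnd ℂ (θ' (b * h * b⁻¹))) *
        (D.orbSum ε l (D.c a x) * starRingEnd ℂ (D.orbSum ε l' (D.c b x))) := by
    intro h x
    rw [superSum, superSum, map_sum, Finset.sum_mul_sum]
    refine Finset.sum_congr rfl fun a _ => Finset.sum_congr rfl fun b _ => ?_
    rw [map_mul]
    ring
  have hswap : ∑ h, ∑ x, D.superSum ε θ l h x * starRingEnd ℂ (D.superSum ε θ' l' h x) =
      ∑ a, ∑ b, (∑ h, θ (a * h * a⁻¹) * starRingEnd ℂ (θ' (b * h * b⁻¹))) *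
        ∑ x, D.orbSum ε l (D.c a x) * starRingEnd ℂ (D.orbSum ε l' (D.c b x)) := by
    simp_rw [hexp, Finset.sum_mul_sum]
    calc _ = ∑ h, ∑ a, ∑ x, ∑ b, (θ (a * h * a⁻¹) * starRingEnd ℂ (θ' (b * h * b⁻¹))) *
        (D.orbSum ε l (D.c a x) * starRingEnd ℂ (D.orbSum ε l' (D.c b x))) :=
          Finset.sum_congr rfl fun h _ => Finset.sum_comm
      _ = ∑ a, ∑ h, ∑ x, ∑ b, (θ (a * h * a⁻¹) * starRingEnd ℂ (θ' (b * h * b⁻¹))) *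
        (D.orbSum ε l (D.c a x) * starRingEnd ℂ (D.orbSum ε l' (D.c b x))) := Finset.sum_comm
      _ = ∑ a, ∑ h, ∑ b, ∑ x, (θ (a * h * a⁻¹) * starRingEnd ℂ (θ' (b * h * b⁻¹))) *
        (D.orbSum ε l (D.c a x) * starRingEnd ℂ (D.orbSum ε l' (D.c b x))) :=
          Finset.sum_congr rfl fun a _ => Finset.sum_congr rfl fun h _ => Finset.sum_comm
      _ = _ := Finset.sum_congr rfl fun a _ => Finset.sum_comm
  rw [hswap]
  refine Finset.sum_eq_zero fun a _ => Finset.sum_eq_zero fun b _ => ?_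
  by_cases hab : D.Ad (b * a⁻¹) l ∈ D.orb l'
  · have hcomp := hθ.comp (MulAut.conj (b * a⁻¹)⁻¹) (H' := D.fixer l') (S' := D.stab l')
      (fun x => by simpa [mul_assoc] using D.mem_fixer_iff_of_Ad hab x)
      (fun x => by simpa [mul_assoc] using D.mem_stab_iff_of_Ad hab x)
    have horth := hcomp.orthogonal hθ' fun he => hne _ hab fun x => by
      rw [← he]
      simp [mul_assoc]
    rw [← Equiv.sum_comp (MulAut.conj b).toEquiv] at horth
    rw [show ∑ h, θ (a * h * a⁻¹) * starRingEnd ℂ (θ' (b * h * b⁻¹)) = 0 from ?_, zero_mul]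
    rw [← horth]
    refine Finset.sum_congr rfl fun h _ => ?_
    simp [mul_assoc]
  · rw [D.sum_orbSum_mul_conj hε hab, mul_zero]

/-- The Fourier transform in the second variable. -/
noncomputable def fourier (ε : AddChar F ℂ) (f : L → J → ℂ) (h : L) (μ : Dual F J) : ℂ :=
  ∑ x, f h x * starRingEnd ℂ (ε (μ x))

omit [Fintype ι] [Fintype L] [Finite F] hε in
theorem fourier_T {f : L → J → ℂ} (hT : ∀ h i x, f h (D.T i x) = f h x) (h : L) (i : ι)
    (μ : Dual F J) : fourier ε f h (μ ∘ₗ D.T i) = fourier ε f h μ := by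
  obtain ⟨j, hj⟩ := D.exists_rightInverse i
  have hsurj : Function.Surjective (D.T i) := fun x => ⟨D.T j x, LinearMap.congr_fun hj x⟩
  refine Fintype.sum_bijective (D.T i) (Finite.injective_iff_bijective.mp
    (Finite.injective_iff_surjective.mpr hsurj)) _ _ fun x => ?_
  rw [hT]
  rfl

omit [Fintype ι] [Fintype L] [Finite F] hε in
theorem fourier_conj {f : L → J → ℂ} (hc : ∀ r h x, f (r * h * r⁻¹) (D.c r x) = f h x)
    (r h : L) (μ : Dual F J) :
    fourier ε f (r * h * r⁻¹) μ = fourier ε f h (μ ∘ₗ D.c r) := by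
  symm
  have hsurj : Function.Surjective (D.c r) := fun x => ⟨D.c r⁻¹ x, D.c_apply_inv_apply r x⟩
  refine Fintype.sum_bijective (D.c r) (Finite.injective_iff_bijective.mp
    (Finite.injective_iff_surjective.mpr hsurj)) _ _ fun x => ?_
  rw [hc]
  rfl

omit [Fintype ι] [Fintype L] in
theorem fourier_eq_zero {f : L → J → ℂ} (hK : ∀ h x, ∀ y ∈ D.fixedKernel h, f h (x + y) = f h x)
    {h : L} {μ : Dual F J} (hμ : h ∉ D.fixer μ) : fourier ε f h μ = 0 := by
  obtain ⟨y, hy, hne⟩ := D.exists_mem_fixedKernel hμ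
  obtain ⟨t, ht⟩ := exists_addChar_ne_one hε
  have hy' := D.smul_mem_fixedKernel hy (-(t / μ y))
  have key : ε t * fourier ε f h μ = fourier ε f h μ := by
    conv_rhs => rw [fourier, ← Equiv.sum_comp (Equiv.addRight (-(t / μ y) • y))]
    rw [fourier, Finset.mul_sum]
    refine Finset.sum_congr rfl fun x _ => ?_
    simp only [Equiv.coe_addRight]
    rw [hK h x _ hy', map_add, map_smul, smul_eq_mul, neg_mul, div_mul_cancel₀ t hne,
      AddChar.map_add_eq_mul, map_mul, conj_addChar_apply ε (-t), neg_neg]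
    ring
  have : (ε t - 1) * fourier ε f h μ = 0 := by rw [sub_mul, key, one_mul, sub_self]
  exact (mul_eq_zero.mp this).resolve_left (sub_ne_zero.mpr ht)

omit [Finite F] hε in
theorem sum_mul_conj_superSum {f : L → J → ℂ} (hT : ∀ h i x, f h (D.T i x) = f h x)
    (hc : ∀ r h x, f (r * h * r⁻¹) (D.c r x) = f h x) (θ : L → ℂ) (l : Dual F J) :
    ∑ h, ∑ x, f h x * starRingEnd ℂ (D.superSum ε θ l h x) =
      Fintype.card L * (Fintype.card ι * ∑ h, fourier ε f h l * starRingEnd ℂ (θ h)) := by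
  have h1 : ∀ a h, ∑ x, f h x * starRingEnd ℂ (θ (a * h * a⁻¹) * D.orbSum ε l (D.c a x)) =
      Fintype.card ι * (fourier ε f (a * h * a⁻¹) l * starRingEnd ℂ (θ (a * h * a⁻¹))) := by
    intro a h
    have h2 : ∀ i, ∑ x, f h x * starRingEnd ℂ (ε (l (D.T i (D.c a x)))) =
        fourier ε f (a * h * a⁻¹) l := by
      intro i
      rw [← D.fourier_T hT _ i, D.fourier_conj hc]
      rfl
    calc _ = starRingEnd ℂ (θ (a * h * a⁻¹)) *
          ∑ x, ∑ i, f h x * starRingEnd ℂ (ε (l (D.T i (D.c a x)))) := by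
          rw [Finset.mul_sum]
          refine Finset.sum_congr rfl fun x _ => ?_
          rw [← Finset.mul_sum, map_mul, orbSum, map_sum]
          ring
      _ = _ := by
          rw [Finset.sum_comm]
          simp only [h2, Finset.sum_const, Finset.card_univ, nsmul_eq_mul]
          ring
  calc _ = ∑ a, ∑ h, ∑ x, f h x * starRingEnd ℂ (θ (a * h * a⁻¹) * D.orbSum ε l (D.c a x)) := by
        symm
        rw [Finset.sum_comm]
        refine Finset.sum_congr rfl fun h _ => ?_
        rw [Finset.sum_comm]
        refine Finset.sum_congr rfl fun x _ => ?_
        rw [superSum, map_sum, Finset.mul_sum]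
    _ = ∑ a : L, Fintype.card ι * ∑ h, fourier ε f h l * starRingEnd ℂ (θ h) := by
        refine Finset.sum_congr rfl fun a _ => ?_
        rw [Finset.mul_sum]
        exact Fintype.sum_equiv (MulAut.conj a).toEquiv _ _ fun h => h1 a h
    _ = _ := by simp

omit [Group L] [Fintype L] in
theorem eq_zero_of_fourier_eq_zero {f : L → J → ℂ} (h0 : ∀ h μ, fourier ε f h μ = 0) : f = 0 := by
  have : Finite (Dual F J) := DFunLike.finite _
  have : Fintype (Dual F J) := Fintype.ofFinite _
  ext h x
  have h1 : ∑ μ : Dual F J, fourier ε f h μ * ε (μ x) = Fintype.card (Dual F J) * f h x := by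
    calc _ = ∑ y, ∑ μ : Dual F J, f h y * ε (μ (x - y)) := by
          simp_rw [fourier, Finset.sum_mul]
          rw [Finset.sum_comm]
          refine Finset.sum_congr rfl fun y _ => Finset.sum_congr rfl fun μ _ => ?_
          rw [conj_addChar_apply, map_sub, sub_eq_add_neg, AddChar.map_add_eq_mul]
          ring
      _ = _ := by
          rw [Finset.sum_eq_single x]
          · simp [mul_comm]
          · intro y _ hy
            rw [← Finset.mul_sum, sum_dual_addChar hε (sub_ne_zero.mpr hy.symm), mul_zero]
          · simp
  simp only [h0, zero_mul, Finset.sum_const_zero] at h1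
  exact (mul_eq_zero.mp h1.symm).resolve_left (by simp [Fintype.card_ne_zero])

theorem eq_zero_of_forall_superSum {f : L → J → ℂ}
    (hK : ∀ h i x, ∀ y ∈ D.fixedKernel h, f h (D.T i x + y) = f h x)
    (hc : ∀ r h x, f (r * h * r⁻¹) (D.c r x) = f h x)
    (h0 : ∀ l θ, IsOrbitIrrOn (D.fixer l : Set L) (D.stab l) θ →
      ∑ h, ∑ x, f h x * starRingEnd ℂ (D.superSum ε θ l h x) = 0) : f = 0 := by
  obtain ⟨i₀, hi₀⟩ := D.exists_one
  have hT : ∀ h i x, f h (D.T i x) = f h x := fun h i x => by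
    simpa using hK h i x 0 (D.zero_mem_fixedKernel h)
  have hK' : ∀ h x, ∀ y ∈ D.fixedKernel h, f h (x + y) = f h x := fun h x y hy => by
    simpa [hi₀] using hK h i₀ x y hy
  refine eq_zero_of_fourier_eq_zero hε fun h l => ?_
  have key : (fun h => starRingEnd ℂ (fourier ε f h l)) = 0 := by
    refine eq_zero_of_forall_isOrbitIrrOn (D.fixer_le_stab l)
      (fun s hs x => D.mem_fixer_iff_conj hs x) _ ?_ ?_ ?_
    · intro x hx
      rw [D.fourier_eq_zero hε hK' hx, map_zero]
    · intro s hs x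
      obtain ⟨i, hi⟩ := D.Ad_mem_orb_of_mem_stab ((D.stab l).inv_mem hs)
      have h2 : l ∘ₗ D.c s = l ∘ₗ D.T i := by rw [← hi, Ad, inv_inv]
      rw [D.fourier_conj hc, h2, D.fourier_T hT]
    · intro θ hθ
      have h1 := h0 l θ hθ
      rw [D.sum_mul_conj_superSum hT hc] at h1
      have : Nonempty ι := ⟨i₀⟩
      have h2 := (mul_eq_zero.mp h1).resolve_left (by simp [Fintype.card_ne_zero])
      have h3 := (mul_eq_zero.mp h2).resolve_left (by simp [Fintype.card_ne_zero])
      have h4 := congrArg (starRingEnd ℂ) h3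
      simpa using h4
  simpa using congrFun key h

end OperatorFamily

end OperatorFamilies

section AlgebraGroupExtensions

/-- The semidirect product `G` of a finite group `L` with the algebra group `1 + J` of a
nilpotent algebra `J`. -/
structure AlgebraGroupExtension (F J L G : Type) [Field F] [NonUnitalRing J] [Module F J]
    [Group L] [Group G] where
  lact : L → J → J
  ract : J → L → J
  lact_linear : ∀ h, IsLinearMap F (lact h)
  ract_linear : ∀ h, IsLinearMap F (fun x => ract x h)
  lact_one : ∀ x, lact 1 x = x
  lact_mul : ∀ h k x, lact (h * k) x = lact h (lact k x)
  ract_one : ∀ x, ract x 1 = x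
  ract_mul : ∀ h k x, ract x (h * k) = ract (ract x h) k
  ract_lact : ∀ h k x, ract (lact h x) k = lact h (ract x k)
  lact_mul_right : ∀ h x y, lact h (x * y) = lact h x * y
  ract_mul_left : ∀ h x y, ract (x * y) h = x * ract y h
  mul_lact : ∀ h x y, x * lact h y = ract x h * y
  ρ : L →* G
  em : J → G
  em_mul_em : ∀ x y, em x * em y = em (x + y + x * y)
  bijective : Function.Bijective fun p : L × J => ρ p.1 * em p.2
  conj_em : ∀ h x, ρ h * em x * (ρ h)⁻¹ = em (lact h (ract x h⁻¹))

namespace AlgebraGroupExtension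

open Module

variable {F J L G : Type} [Field F] [NonUnitalRing J] [Module F J]
  [Group L] [Group G] (E : AlgebraGroupExtension F J L G)

theorem ract_add (x y : J) (h : L) : E.ract (x + y) h = E.ract x h + E.ract y h :=
  (E.ract_linear h).map_add x y

theorem lact_add (x y : J) (h : L) : E.lact h (x + y) = E.lact h x + E.lact h y :=
  (E.lact_linear h).map_add x y

theorem lact_lact_inv (h : L) (x : J) : E.lact h (E.lact h⁻¹ x) = x := by
  rw [← E.lact_mul, mul_inv_cancel, E.lact_one]

theorem ract_inv_ract (h : L) (x : J) : E.ract (E.ract x h⁻¹) h = x := by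
  rw [← E.ract_mul, inv_mul_cancel, E.ract_one]

theorem em_zero : E.em 0 = 1 := by
  have := E.em_mul_em 0 0
  simpa using this

theorem em_injective : Function.Injective E.em := by
  intro x y h
  have := E.bijective.1 (a₁ := (1, x)) (a₂ := (1, y)) (by simpa using h)
  exact (Prod.ext_iff.mp this).2

theorem exists_em_inv (y : J) : ∃ z, E.em z = (E.em y)⁻¹ := by
  obtain ⟨⟨h, z⟩, hz⟩ := E.bijective.2 (E.em y)⁻¹
  have h1 : E.ρ h * E.em (z + y + z * y) = E.ρ 1 * E.em 0 := by
    rw [← E.em_mul_em, ← mul_assoc, map_one, E.em_zero, mul_one]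
    exact (eq_inv_iff_mul_eq_one.mp hz)
  have h2 : h = 1 := (Prod.ext_iff.mp (E.bijective.1 (a₁ := (h, _)) (a₂ := (1, 0)) h1)).1
  subst h2
  exact ⟨z, by simpa using hz⟩

/-- The quasi-inverse: `(1 + y)⁻¹ = 1 + E.qinv y`. -/
noncomputable def qinv (y : J) : J := (E.exists_em_inv y).choose

theorem em_qinv (y : J) : E.em (E.qinv y) = (E.em y)⁻¹ := (E.exists_em_inv y).choose_spec

theorem qinv_add (y : J) : E.qinv y + y + E.qinv y * y = 0 := by
  refine E.em_injective ?_
  rw [← E.em_mul_em, em_qinv, inv_mul_cancel, em_zero]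

include E in
theorem circ_left_injective (z : J) : Function.Injective fun y => z + y + z * y := by
  intro y y' h
  have h' := congrArg E.em h
  simp only [← E.em_mul_em, mul_right_inj] at h'
  exact E.em_injective h'

include E in
theorem circ_right_injective (z : J) : Function.Injective fun y => y + z + y * z := by
  intro y y' h
  have h' := congrArg E.em h
  simp only [← E.em_mul_em, mul_left_inj] at h'
  exact E.em_injective h'

theorem c_mul (a : L) (x y : J) :
    E.ract (E.lact a (x * y)) a⁻¹ = E.ract (E.lact a x) a⁻¹ * E.ract (E.lact a y) a⁻¹ := by
  rw [E.lact_mul_right, E.ract_mul_left, E.ract_lact a a⁻¹ y, E.mul_lact, ract_inv_ract]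

/-- The conjugation action of `L` on `J`. -/
def c : L →* End F J where
  toFun a :=
    { toFun x := E.ract (E.lact a x) a⁻¹
      map_add' x y := by rw [lact_add, ract_add]
      map_smul' t x := by
        have h1 := (E.lact_linear a).map_smul t x
        have h2 := (E.ract_linear a⁻¹).map_smul t (E.lact a x)
        rw [h1, h2]
        rfl }
  map_one' := by
    ext x
    simp [E.lact_one, E.ract_one]
  map_mul' a b := by
    ext x
    simp [E.lact_mul, E.ract_mul, E.ract_lact]

theorem c_apply (a : L) (x : J) : E.c a x = E.ract (E.lact a x) a⁻¹ := rfl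

theorem c_apply' (a : L) (x : J) : E.c a x = E.lact a (E.ract x a⁻¹) := by
  rw [c_apply, E.ract_lact]

theorem c_apply_mul (a : L) (x y : J) : E.c a (x * y) = E.c a x * E.c a y := E.c_mul a x y

theorem c_inv_c (a : L) (x : J) : E.c a⁻¹ (E.c a x) = x := by
  rw [← End.mul_apply, ← map_mul, inv_mul_cancel, map_one, End.one_apply]

theorem c_injective (a : L) : Function.Injective (E.c a) :=
  Function.LeftInverse.injective (E.c_inv_c a)

theorem ract_mul_eq (x w : J) (k : L) : E.ract (x * w) k = E.ract x k * E.c k⁻¹ w := by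
  rw [E.ract_mul_left, ← E.mul_lact, c_apply', inv_inv, lact_lact_inv]

variable [SMulCommClass F J J] [IsScalarTower F J J]

/-- The operator `x ↦ (1 + z) x k (1 + w)`. -/
def T (i : J × L × J) : End F J where
  toFun x := E.ract (x + i.1 * x) i.2.1 + E.ract (x + i.1 * x) i.2.1 * i.2.2
  map_add' x y := by
    simp only [ract_add, mul_add, add_mul]
    abel
  map_smul' t x := by
    have h1 : t • x + i.1 * t • x = t • (x + i.1 * x) := by rw [mul_smul_comm, smul_add]
    have h2 := (E.ract_linear i.2.1).map_smul t (x + i.1 * x)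
    rw [h1, h2, smul_mul_assoc, ← smul_add]
    rfl

theorem T_apply (i : J × L × J) (x : J) :
    E.T i x = E.ract (x + i.1 * x) i.2.1 + E.ract (x + i.1 * x) i.2.1 * i.2.2 := rfl

theorem T_mul_T (z z' w w' : J) (k k' : L) :
    E.T (z', k', w') * E.T (z, k, w) =
      E.T (z' + z + z' * z, k * k', E.c k'⁻¹ w + w' + E.c k'⁻¹ w * w') := by
  ext x
  simp only [End.mul_apply, T_apply]
  have h1 : x + (z' + z + z' * z) * x = (x + z * x) + z' * (x + z * x) := by
    simp only [mul_add, add_mul, mul_assoc]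
    abel
  rw [h1]
  generalize x + z * x = X
  have h2 : E.ract (X + z' * X) (k * k') = E.ract (E.ract X k + z' * E.ract X k) k' := by
    rw [E.ract_mul, ract_add, E.ract_mul_left]
  rw [h2]
  generalize E.ract X k = Y
  have h3 : Y + Y * w + z' * (Y + Y * w) = (Y + z' * Y) + (Y + z' * Y) * w := by
    simp only [mul_add, add_mul, mul_assoc]
    abel
  rw [h3, ract_add, ract_mul_eq]
  simp only [mul_add, add_mul, mul_assoc]
  abel

theorem c_mul_T (a : L) (z w : J) (k : L) :
    E.c a * E.T (z, k, w) = E.T (E.c a z, a * k * a⁻¹, E.c a w) * E.c a := by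
  ext x
  have h : ∀ y, E.ract (E.c a y) (a * k * a⁻¹) = E.c a (E.ract y k) := fun y => by
    rw [E.ract_mul, E.ract_mul, c_apply, ract_inv_ract, c_apply, E.ract_lact]
  simp only [End.mul_apply, T_apply]
  rw [← c_apply_mul, ← map_add, h, ← c_apply_mul, ← map_add]

variable [Finite J] [Finite L]

/-- The two-sided operators on `J`, with the conjugation action of `L`. -/
def opFamily : OperatorFamily F J L (J × L × J) where
  T := E.T
  c := E.c
  exists_one := ⟨(0, 1, 0), by ext x; simp [T_apply, E.ract_one]⟩
  exists_mul_left := by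
    rintro ⟨z', k', w'⟩
    refine ⟨Equiv.ofBijective (fun j => (z' + j.1 + z' * j.1, j.2.1 * k',
      E.c k'⁻¹ j.2.2 + w' + E.c k'⁻¹ j.2.2 * w')) (Finite.injective_iff_bijective.mp ?_), ?_⟩
    · rintro ⟨z, k, w⟩ ⟨z₁, k₁, w₁⟩ h
      simp only [Prod.mk.injEq, mul_left_inj] at h ⊢
      exact ⟨E.circ_left_injective z' h.1, h.2.1,
        E.c_injective _ (E.circ_right_injective w' h.2.2)⟩
    · rintro ⟨z, k, w⟩
      exact (E.T_mul_T ..).symm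
  exists_mul_right := by
    rintro ⟨z, k, w⟩
    have hinj : Function.Injective fun j : J × L × J => (j.1 + z + j.1 * z, k * j.2.1,
        E.c j.2.1⁻¹ w + j.2.2 + E.c j.2.1⁻¹ w * j.2.2) := by
      rintro ⟨z', k', w'⟩ ⟨z₁, k₁, w₁⟩ h
      simp only [Prod.mk.injEq, mul_right_inj] at h ⊢
      obtain ⟨h1, rfl, h3⟩ := h
      exact ⟨E.circ_right_injective z h1, rfl, E.circ_left_injective _ h3⟩
    exact ⟨Equiv.ofBijective _ (Finite.injective_iff_bijective.mp hinj),
      fun ⟨z', k', w'⟩ => (E.T_mul_T ..).symm⟩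
  exists_conj := by
    intro a
    have hinj : Function.Injective fun j : J × L × J => (E.c a j.1, a * j.2.1 * a⁻¹,
        E.c a j.2.2) := by
      rintro ⟨z', k', w'⟩ ⟨z₁, k₁, w₁⟩ h
      simp only [Prod.mk.injEq, mul_right_inj, mul_left_inj] at h ⊢
      exact ⟨E.c_injective a h.1, h.2.1, E.c_injective a h.2.2⟩
    exact ⟨Equiv.ofBijective _ (Finite.injective_iff_bijective.mp hinj),
      fun ⟨z', k', w'⟩ => (E.c_mul_T ..).symm⟩

end AlgebraGroupExtension

end AlgebraGroupExtensions

namespace AlgebraGroupExtension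

open Module

variable {F J L G : Type} [Field F] [NonUnitalRing J] [Module F J]
  [Group L] [Group G] (E : AlgebraGroupExtension F J L G)

/-- The decomposition `g = h (1 + x)`. -/
noncomputable def dec : G → L × J :=
  @Function.invFun (L × J) G ⟨(1, 0)⟩ fun p : L × J => E.ρ p.1 * E.em p.2

theorem dec_mul (h : L) (x : J) : E.dec (E.ρ h * E.em x) = (h, x) :=
  @Function.leftInverse_invFun _ _ ⟨(1, 0)⟩ _ E.bijective.1 (h, x)

theorem em_mul_rho (y : J) (h : L) : E.em y * E.ρ h = E.ρ h * E.em (E.c h⁻¹ y) := by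
  rw [c_apply', ← E.conj_em, map_inv]
  group

theorem mul_mul_mul (h k : L) (x y : J) :
    E.ρ h * E.em x * (E.ρ k * E.em y) =
      E.ρ (h * k) * E.em (E.c k⁻¹ x + y + E.c k⁻¹ x * y) := by
  rw [← E.em_mul_em, map_mul, mul_assoc, ← mul_assoc (E.em x), em_mul_rho]
  simp only [mul_assoc]

theorem rho_conj (r h : L) (x : J) :
    E.ρ r * (E.ρ h * E.em x) * (E.ρ r)⁻¹ = E.ρ (r * h * r⁻¹) * E.em (E.c r x) := by
  rw [c_apply', ← E.conj_em, map_mul, map_mul, map_inv]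
  group

/-- The component in `J` of the conjugate of `h (1 + x)` by `1 + y`. -/
noncomputable def conjElt (h : L) (x y : J) : J :=
  E.c h⁻¹ y + x + E.c h⁻¹ y * x + E.qinv y + (E.c h⁻¹ y + x + E.c h⁻¹ y * x) * E.qinv y

theorem em_conj (h : L) (x y : J) :
    E.em y * (E.ρ h * E.em x) * (E.em y)⁻¹ = E.ρ h * E.em (E.conjElt h x y) := by
  rw [conjElt, ← E.em_mul_em, ← E.em_mul_em, ← mul_assoc, em_mul_rho, em_qinv]
  simp only [mul_assoc]

theorem conjElt_mul (h : L) (x y : J) :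
    E.conjElt h x y + E.conjElt h x y * y = x + E.c h⁻¹ y * x + (E.c h⁻¹ y - y) := by
  have h1 := E.qinv_add y
  have h2 : E.qinv y + E.qinv y * y = - y := by
    rw [eq_neg_iff_add_eq_zero, ← h1]
    abel
  rw [conjElt]
  generalize E.c h⁻¹ y = y'
  calc _ = (y' + x + y' * x) + (y' + x + y' * x) * y + (E.qinv y + E.qinv y * y) +
      (y' + x + y' * x) * (E.qinv y + E.qinv y * y) := by
        simp only [mul_add, add_mul, mul_assoc]
        abel
    _ = _ := by
        rw [h2, mul_neg]
        abel

theorem bijective_em_mul_rho [Finite J] [Finite L] :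
    Function.Bijective fun p : L × J => E.em p.2 * E.ρ p.1 := by
  have h1 : (fun p : L × J => E.em p.2 * E.ρ p.1) =
      (fun p : L × J => E.ρ p.1 * E.em p.2) ∘ fun p => (p.1, E.c p.1⁻¹ p.2) := by
    ext p
    exact E.em_mul_rho _ _
  rw [h1]
  refine E.bijective.comp (Finite.injective_iff_bijective.mp ?_)
  rintro ⟨a, x⟩ ⟨b, y⟩ h
  simp only [Prod.mk.injEq] at h
  obtain ⟨rfl, h2⟩ := h
  rw [E.c_injective _ h2]

/-- The right radical of the form `(x, y) ↦ l (x y)`. -/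
def rad (l : Dual F J) : Set J := {z | ∀ w, l (z * w) = 0}

variable [Fintype L] [Fintype G]

/-- The function on `G` inflating `∑ p, ξ_{θ, pl}` by zero. -/
noncomputable def xi (ε : AddChar F ℂ) (H : Set L) (θ : L → ℂ) (l : Dual F J) (s : G) : ℂ :=
  if (E.dec s).1 ∈ H ∧ (E.dec s).2 ∈ rad l then
    ∑ p : L, θ (E.dec s).1 * ε (l (E.ract (E.dec s).2 p))
  else 0

/-- The function on `G` induced by `E.xi ε H θ l`. -/
noncomputable def chi (ε : AddChar F ℂ) (H : Set L) (θ : L → ℂ) (l : Dual F J) (g : G) : ℂ :=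
  ((Nat.card ↥H * Nat.card ↥(rad l) : ℕ) : ℂ)⁻¹ * ∑ s : G, E.xi ε H θ l (s * g * s⁻¹)

theorem sum_conj_eq [Fintype J] (f : G → ℂ) (h : L) (x : J) :
    ∑ s, f (s * (E.ρ h * E.em x) * s⁻¹) =
      ∑ a, ∑ y, f (E.ρ (a * h * a⁻¹) * E.em (E.conjElt (a * h * a⁻¹) (E.c a x) y)) := by
  rw [← Fintype.sum_prod_type', ← Function.Bijective.sum_comp E.bijective_em_mul_rho]
  refine Finset.sum_congr rfl fun p _ => ?_
  rw [← em_conj, ← rho_conj]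
  congr 1
  group

omit [Fintype L] [Fintype G] in
theorem ract_mul_lact (X w : J) (p : L) : E.ract X p * w = X * E.lact p w := by
  rw [E.mul_lact]

variable [SMulCommClass F J J] [IsScalarTower F J J]
variable [Finite F] {ε : AddChar F ℂ} (hε : ε ≠ 1)

omit [Fintype L] [Fintype G] [IsScalarTower F J J] in
include hε in
theorem rad_indicator [Fintype J] (l : Dual F J) (X : J) (p : L) :
    (if X ∈ rad l then ε (l (E.ract X p)) else 0) =
      (Fintype.card J : ℂ)⁻¹ * ∑ w, ε (l (E.ract X p + E.ract X p * w)) := by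
  have h1 : ∑ w, ε (l (E.ract X p + E.ract X p * w)) =
      ε (l (E.ract X p)) * ∑ w, ε ((l ∘ₗ LinearMap.mulLeft F (E.ract X p)) w) := by
    rw [Finset.mul_sum]
    refine Finset.sum_congr rfl fun w _ => ?_
    rw [map_add, AddChar.map_add_eq_mul]
    rfl
  rw [h1]
  split_ifs with hX
  · have h2 : ∀ w, (l ∘ₗ LinearMap.mulLeft F (E.ract X p)) w = 0 := fun w => by
      simp only [LinearMap.comp_apply, LinearMap.mulLeft_apply, ract_mul_lact]
      exact hX _
    have : (Fintype.card J : ℂ) ≠ 0 := by simp [Fintype.card_ne_zero]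
    simp only [h2, AddChar.map_zero_eq_one, Finset.sum_const, Finset.card_univ, nsmul_eq_mul,
      mul_one]
    field_simp
  · have hne : l ∘ₗ LinearMap.mulLeft F (E.ract X p) ≠ 0 := fun h0 => hX fun w => by
      have := LinearMap.congr_fun h0 (E.lact p⁻¹ w)
      simpa [ract_mul_lact, lact_lact_inv] using this
    have h2 := OperatorFamily.sum_addChar_mul_conj hε hne
    simp only [LinearMap.zero_apply, AddChar.map_zero_eq_one, map_one, mul_one] at h2
    rw [h2, mul_zero, mul_zero]

omit [Fintype G] in
include hε in
theorem sum_conjElt [Fintype J] {l : Dual F J} {h : L} (hh : h ∈ E.opFamily.fixer l) (x : J) :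
    ∑ y, (if E.conjElt h x y ∈ rad l then ∑ p, ε (l (E.ract (E.conjElt h x y) p)) else 0) =
      (Fintype.card J : ℂ)⁻¹ * E.opFamily.orbSum ε l x := by
  have h1 : ∀ y, (if E.conjElt h x y ∈ rad l then
      ∑ p, ε (l (E.ract (E.conjElt h x y) p)) else 0) =
      (Fintype.card J : ℂ)⁻¹ * ∑ p, ∑ w, ε (l (E.T (E.c h⁻¹ y, p, w) x)) := by
    intro y
    have h2 : (if E.conjElt h x y ∈ rad l then
        ∑ p, ε (l (E.ract (E.conjElt h x y) p)) else 0) =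
        ∑ p, if E.conjElt h x y ∈ rad l then ε (l (E.ract (E.conjElt h x y) p)) else 0 := by
      split_ifs <;> simp
    rw [h2, Finset.mul_sum]
    refine Finset.sum_congr rfl fun p _ => ?_
    rw [E.rad_indicator hε]
    congr 1
    symm
    refine Fintype.sum_bijective (fun w => E.c p⁻¹ y + w + E.c p⁻¹ y * w)
      (Finite.injective_iff_bijective.mp (E.circ_left_injective _)) _ _ fun w => ?_
    congr 1
    set X := E.conjElt h x y with hX
    have h3 : E.ract X p + E.ract X p * (E.c p⁻¹ y + w + E.c p⁻¹ y * w) =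
        E.ract (X + X * y) p + E.ract (X + X * y) p * w := by
      rw [ract_add, ract_mul_eq]
      simp only [mul_add, add_mul, mul_assoc]
      abel
    have h4 := LinearMap.congr_fun (((E.opFamily.mem_fixer).mp hh) (l ∘ₗ E.T (0, p, w))
      ⟨_, rfl⟩) y
    have h5 : l (E.T (0, p, w) (E.c h⁻¹ y)) = l (E.T (0, p, w) y) := h4
    have h6 : ∀ v, E.ract v p + E.ract v p * w = E.T (0, p, w) v := fun v => by
      simp [T_apply]
    have h7 : E.T (E.c h⁻¹ y, p, w) x = E.T (0, p, w) (x + E.c h⁻¹ y * x) := by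
      simp [T_apply]
    rw [h3, h6, h7, hX, conjElt_mul, map_add (E.T _) _ (_ - _), map_sub (E.T _), map_add l,
      map_sub l, h5, sub_self, add_zero]
  simp only [h1]
  rw [← Finset.mul_sum, OperatorFamily.orbSum, Fintype.sum_prod_type]
  congr 1
  refine Fintype.sum_bijective (E.c h⁻¹)
    (Finite.injective_iff_bijective.mp (E.c_injective _)) _ _ fun y => ?_
  rw [Fintype.sum_prod_type]
  rfl

include hε in
theorem chi_eq [Fintype J] {θ : L → ℂ} {l : Dual F J}
    (hθ : ∀ x ∉ E.opFamily.fixer l, θ x = 0) (h : L) (x : J) :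
    E.chi ε (E.opFamily.fixer l) θ l (E.ρ h * E.em x) =
      ((Nat.card (E.opFamily.fixer l) * Nat.card (rad l) * Nat.card J : ℕ) : ℂ)⁻¹ *
        E.opFamily.superSum ε θ l h x := by
  have h1 : ∑ s, E.xi ε (E.opFamily.fixer l) θ l (s * (E.ρ h * E.em x) * s⁻¹) =
      (Fintype.card J : ℂ)⁻¹ * E.opFamily.superSum ε θ l h x := by
    rw [sum_conj_eq, OperatorFamily.superSum, Finset.mul_sum]
    refine Finset.sum_congr rfl fun a _ => ?_
    simp only [xi, dec_mul]
    by_cases ha : a * h * a⁻¹ ∈ E.opFamily.fixer l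
    · have h2 := E.sum_conjElt hε ha (E.c a x)
      rw [show E.opFamily.c a x = E.c a x from rfl, mul_left_comm, ← h2, Finset.mul_sum]
      refine Finset.sum_congr rfl fun y _ => ?_
      simp only [SetLike.mem_coe, ha, true_and, Finset.mul_sum, mul_ite, mul_zero]
    · simp [ha, hθ _ ha]
  rw [chi, h1]
  push_cast
  rw [mul_inv _ (Nat.card J : ℂ), Nat.card_eq_fintype_card (α := J), mul_assoc]

end AlgebraGroupExtension

theorem OperatorFamily.card_fixer_eq_of_Ad {F J L ι : Type} [Field F] [AddCommGroup J]
    [Module F J] [Group L] (D : OperatorFamily F J L ι) {l l' : Module.Dual F J} {r : L}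
    (h : D.Ad r l ∈ D.orb l') : Nat.card (D.fixer l') = Nat.card (D.fixer l) := by
  refine Nat.card_congr ((MulAut.conj r⁻¹).toEquiv.subtypeEquiv fun x => ?_)
  rw [D.mem_fixer_iff_of_Ad h]
  simp

namespace AlgebraGroupExtension

open Module

variable {F J L G : Type} [Field F] [NonUnitalRing J] [Module F J]
  [Group L] [Group G] (E : AlgebraGroupExtension F J L G)
  [SMulCommClass F J J] [IsScalarTower F J J] [Finite J] [Finite L]

omit [Finite J] [Finite L] in
theorem T_mul (z w : J) (k : L) (x y : J) :
    E.T (z, k, w) (x * y) = (x + z * x) * E.T (0, k, w) y := by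
  simp only [T_apply]
  rw [← mul_assoc z, ← add_mul, E.ract_mul_left, zero_mul, add_zero, mul_assoc, ← mul_add]

theorem T_surjective (i : J × L × J) : Function.Surjective (E.T i) := by
  obtain ⟨j, hj⟩ := E.opFamily.exists_rightInverse i
  exact fun x => ⟨E.T j x, LinearMap.congr_fun hj x⟩

theorem card_rad_eq_of_mem {l μ : Dual F J} (h : μ ∈ E.opFamily.orb l) :
    Nat.card (rad μ) = Nat.card (rad l) := by
  obtain ⟨⟨z, k, w⟩, rfl⟩ := h
  have hinj : Function.Injective fun x : J => x + z * x := by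
    intro x y hxy
    have h1 := congrArg (fun v => v + E.qinv z * v) hxy
    have h2 : ∀ v : J, v + z * v + E.qinv z * (v + z * v) = v := fun v => by
      calc _ = v + (E.qinv z + z + E.qinv z * z) * v := by
            simp only [mul_add, add_mul, mul_assoc]
            abel
        _ = v := by rw [qinv_add, zero_mul, add_zero]
    simpa only [h2] using h1
  refine Nat.card_congr ((Equiv.ofBijective _
    (Finite.injective_iff_bijective.mp hinj)).subtypeEquiv fun x => ?_)
  simp only [rad, Set.mem_ofPred_eq, Equiv.ofBijective_apply]
  constructor
  · intro h v
    obtain ⟨v, rfl⟩ := E.T_surjective (0, k, w) v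
    rw [← T_mul]
    exact h v
  · intro h v
    refine Eq.trans (congrArg l (E.T_mul z w k x v)) (h _)

theorem card_rad_Ad (r : L) (l : Dual F J) :
    Nat.card (rad (E.opFamily.Ad r l)) = Nat.card (rad l) := by
  refine Nat.card_congr ((Equiv.ofBijective _
    (Finite.injective_iff_bijective.mp (E.c_injective r⁻¹))).subtypeEquiv fun x => ?_)
  simp only [rad, Set.mem_ofPred_eq, Equiv.ofBijective_apply]
  constructor
  · intro h v
    have := h (E.c r v)
    rw [E.opFamily.Ad_apply] at this
    rw [← E.c_inv_c r v, ← c_apply_mul]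
    exact this
  · intro h v
    rw [E.opFamily.Ad_apply]
    refine Eq.trans (congrArg l (E.c_apply_mul r⁻¹ x v)) (h _)

theorem card_rad_eq_of_Ad {l l' : Dual F J} {r : L}
    (h : E.opFamily.Ad r l ∈ E.opFamily.orb l') : Nat.card (rad l') = Nat.card (rad l) := by
  rw [← E.card_rad_eq_of_mem h, card_rad_Ad]

theorem c_mem_rad {l : Dual F J} {k : L} (hk : k ∈ E.opFamily.fixer l) {x : J}
    (hx : x ∈ rad l) : E.c k⁻¹ x ∈ rad l := by
  intro w
  have h1 := LinearMap.congr_fun (hk l (E.opFamily.mem_orb_self l)) (x * E.c k w)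
  rw [E.opFamily.Ad_apply, hx] at h1
  rw [← E.c_inv_c k w, ← c_apply_mul]
  exact h1

omit [SMulCommClass F J J] [IsScalarTower F J J] [Finite J] in
theorem circ_mem_rad {l : Dual F J} {x y : J} (hx : x ∈ rad l) (hy : y ∈ rad l) :
    x + y + x * y ∈ rad l := by
  intro w
  rw [add_mul, add_mul, map_add, map_add, hx, hy, mul_assoc, hx, add_zero, add_zero]

/-- The subgroup `H ⋉ (1 + rad l)`, where `H` fixes the orbit of `l`. -/
noncomputable def inducingSubgroup [Finite G] (l : Dual F J) : Subgroup G :=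
  let M : Submonoid G :=
    { carrier := {g | (E.dec g).1 ∈ E.opFamily.fixer l ∧ (E.dec g).2 ∈ rad l}
      one_mem' := by
        have h1 : E.dec 1 = (1, 0) := by rw [← E.dec_mul 1 0, map_one, em_zero, one_mul]
        rw [Set.mem_ofPred_eq, h1]
        exact ⟨one_mem _, fun w => by rw [zero_mul, map_zero]⟩
      mul_mem' := by
        intro a b ha hb
        obtain ⟨⟨h, x⟩, rfl⟩ := E.bijective.2 a
        obtain ⟨⟨k, y⟩, rfl⟩ := E.bijective.2 b
        simp only [Set.mem_ofPred_eq, mul_mul_mul, dec_mul] at ha hb ⊢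
        exact ⟨mul_mem ha.1 hb.1, circ_mem_rad (E.c_mem_rad hb.1 ha.2) hb.2⟩ }
  { M with
    inv_mem' := fun {g} hg => by
      have h1 : g ^ (Nat.card G - 1) ∈ M := pow_mem hg _
      have h2 : g⁻¹ = g ^ (Nat.card G - 1) := by
        rw [inv_eq_iff_mul_eq_one, ← pow_succ', Nat.sub_add_cancel Nat.card_pos, pow_card_eq_one']
      rw [h2]
      exact h1 }

variable [Finite G]

theorem mem_inducingSubgroup {l : Dual F J} {g : G} : g ∈ E.inducingSubgroup l ↔
    (E.dec g).1 ∈ E.opFamily.fixer l ∧ (E.dec g).2 ∈ rad l := Iff.rfl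

theorem card_inducingSubgroup (l : Dual F J) :
    Nat.card (E.inducingSubgroup l) = Nat.card (E.opFamily.fixer l) * Nat.card (rad l) := by
  rw [← Nat.card_prod]
  symm
  refine Nat.card_congr (Equiv.subtypeProdEquivProd.symm.trans
    ((Equiv.ofBijective _ E.bijective).subtypeEquiv fun p => ?_))
  rw [mem_inducingSubgroup, Equiv.ofBijective_apply, dec_mul]

/-- The representation `h (1 + x) ↦ ε (l (x p)) • σ h`. -/
noncomputable def twistedRep (ε : AddChar F ℂ) (l : Dual F J) (p : L) {W : Type} [AddCommGroup W]
    [Module ℂ W] (σ : Representation ℂ (E.opFamily.fixer l) W) :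
    Representation ℂ (E.inducingSubgroup l) W where
  toFun g := ε (l (E.ract (E.dec g).2 p)) • σ ⟨(E.dec g).1, g.2.1⟩
  map_one' := by
    have h1 : E.dec 1 = (1, 0) := by rw [← E.dec_mul 1 0, map_one, em_zero, one_mul]
    have h2 : E.ract 0 p = 0 := (E.ract_linear p).map_zero
    simp only [OneMemClass.coe_one, h1, h2, map_zero, AddChar.map_zero_eq_one, one_smul]
    exact map_one σ
  map_mul' := by
    rintro ⟨a, ha⟩ ⟨b, hb⟩
    obtain ⟨⟨h, x⟩, rfl⟩ := E.bijective.2 a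
    obtain ⟨⟨k, y⟩, rfl⟩ := E.bijective.2 b
    rw [mem_inducingSubgroup, dec_mul] at ha hb
    have h1 : l (E.ract (E.c k⁻¹ x) p) = l (E.ract x p) := by
      have h2 := LinearMap.congr_fun (((E.opFamily.mem_fixer).mp hb.1) (l ∘ₗ E.T (0, p, 0))
        ⟨_, rfl⟩) x
      have h3 : ∀ v, E.T (0, p, 0) v = E.ract v p := fun v => by simp [T_apply]
      have h4 : l (E.T (0, p, 0) (E.c k⁻¹ x)) = l (E.T (0, p, 0) x) := h2
      rwa [h3, h3] at h4
    have h5 : l (E.ract (E.c k⁻¹ x + y + E.c k⁻¹ x * y) p) =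
        l (E.ract x p) + l (E.ract y p) := by
      rw [ract_add, ract_add, map_add, map_add, E.ract_mul_left, E.c_mem_rad hb.1 ha.2, h1,
        add_zero]
    have h6 : σ ⟨h * k, mul_mem ha.1 hb.1⟩ = σ ⟨h, ha.1⟩ * σ ⟨k, hb.1⟩ :=
      map_mul σ ⟨h, ha.1⟩ ⟨k, hb.1⟩
    simp only [MulMemClass.mk_mul_mk, mul_mul_mul, dec_mul, h5, AddChar.map_add_eq_mul]
    rw [h6, smul_mul_smul_comm]

theorem character_twistedRep (ε : AddChar F ℂ) (l : Dual F J) (p : L) {W : Type}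
    [AddCommGroup W] [Module ℂ W] (σ : Representation ℂ (E.opFamily.fixer l) W)
    (g : E.inducingSubgroup l) : (E.twistedRep ε l p σ).character g =
      ε (l (E.ract (E.dec g).2 p)) * σ.character ⟨(E.dec g).1, g.2.1⟩ :=
  map_smul (LinearMap.trace ℂ W) _ _

theorem isCharacter_chi [Fintype L] [Fintype G] (ε : AddChar F ℂ) {l : Dual F J} {θ : L → ℂ}
    {S : Set L} (hθ : IsOrbitIrrOn (E.opFamily.fixer l : Set L) S θ) :
    IsCharacter (E.chi ε (E.opFamily.fixer l) θ l) := by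
  obtain ⟨A, hA, -, hsum⟩ := hθ
  let φ : L → (L → ℂ) → G → ℂ := fun p ψ g => (Nat.card (E.inducingSubgroup l) : ℂ)⁻¹ *
    ∑ s : G, if s * g * s⁻¹ ∈ E.inducingSubgroup l then
      ε (l (E.ract (E.dec (s * g * s⁻¹)).2 p)) * ψ (E.dec (s * g * s⁻¹)).1 else 0
  have key : E.chi ε (E.opFamily.fixer l) θ l = ∑ p, ∑ ψ ∈ A, φ p ψ := by
    ext g
    simp only [Finset.sum_apply, φ, ← Finset.mul_sum, card_inducingSubgroup]
    rw [chi]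
    congr 1
    have hcomm : ∀ f : L → (L → ℂ) → G → ℂ,
        ∑ p, ∑ ψ ∈ A, ∑ s, f p ψ s = ∑ s, ∑ p, ∑ ψ ∈ A, f p ψ s := by
      intro f
      symm
      rw [Finset.sum_comm]
      exact Finset.sum_congr rfl fun p _ => Finset.sum_comm
    rw [hcomm]
    refine Finset.sum_congr rfl fun s _ => ?_
    by_cases hs : s * g * s⁻¹ ∈ E.inducingSubgroup l
    · rw [xi, if_pos (show (E.dec (s * g * s⁻¹)).1 ∈ (E.opFamily.fixer l : Set L) ∧
        (E.dec (s * g * s⁻¹)).2 ∈ rad l from hs)]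
      refine Finset.sum_congr rfl fun p _ => ?_
      rw [hsum, Finset.sum_mul]
      refine Finset.sum_congr rfl fun ψ _ => ?_
      rw [if_pos hs, mul_comm]
    · rw [xi, if_neg (show ¬((E.dec (s * g * s⁻¹)).1 ∈ (E.opFamily.fixer l : Set L) ∧
        (E.dec (s * g * s⁻¹)).2 ∈ rad l) from hs)]
      simp [hs]
  rw [key]
  refine IsCharacter.sum _ _ fun p _ => IsCharacter.sum _ _ fun ψ hψ => ?_
  obtain ⟨-, H₀, hH, W, -, hW⟩ := hA ψ hψ
  obtain rfl : H₀ = E.opFamily.fixer l := SetLike.coe_injective hH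
  convert isCharacter_induced (E.twistedRep ε l p W.ρ) using 4 with g s
  split_ifs with hs
  · rw [character_twistedRep]
    exact congrArg _ (hW ⟨_, hs.1⟩)
  · rfl

end AlgebraGroupExtension

/-- A complete orthogonal family of functions on `G` factoring through a surjection `G → B` has
the cardinality of `B`. -/
theorem card_eq_of_orthogonal_complete {G A B : Type*} [Fintype G] {cls : G → B}
    (hcls : Function.Surjective cls) (χ : A → G → ℂ) (φ : A → B → ℂ)
    (hφ : ∀ a g, χ a g = φ a (cls g)) (hne : ∀ a, χ a ≠ 0)
    (horth : ∀ a a', a ≠ a' → ∑ g, χ a g * starRingEnd ℂ (χ a' g) = 0)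
    (hcomplete : ∀ f : B → ℂ,
      (∀ a, ∑ g, f (cls g) * starRingEnd ℂ (χ a g) = 0) → f = 0) :
    Nat.card A = Nat.card B := by
  have : Finite B := Finite.of_surjective cls hcls
  have : Fintype B := Fintype.ofFinite B
  have hli : LinearIndependent ℂ φ := by
    rw [linearIndependent_iff']
    intro s c hc a ha
    have h1 : ∀ g, ∑ i ∈ s, c i * χ i g = 0 := fun g => by
      simpa [hφ] using congrFun hc (cls g)
    have h2 : ∑ g, (∑ i ∈ s, c i * χ i g) * starRingEnd ℂ (χ a g) =
        c a * ∑ g, χ a g * starRingEnd ℂ (χ a g) := by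
      simp_rw [Finset.sum_mul]
      rw [Finset.sum_comm, Finset.sum_eq_single a, Finset.mul_sum]
      · simp only [mul_assoc]
      · intro i _ hi
        simp only [mul_assoc, ← Finset.mul_sum, horth i a hi, mul_zero]
      · exact fun h => absurd ha h
    simp only [h1, zero_mul, Finset.sum_const_zero] at h2
    refine (mul_eq_zero.mp h2.symm).resolve_right fun h3 => hne a ?_
    simp_rw [Complex.mul_conj] at h3
    rw [← Complex.ofReal_sum, Complex.ofReal_eq_zero,
      Finset.sum_eq_zero_iff_of_nonneg fun g _ => Complex.normSq_nonneg _] at h3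
    ext g
    exact Complex.normSq_eq_zero.mp (h3 g (Finset.mem_univ g))
  have : Finite A := hli.finite
  have : Fintype A := Fintype.ofFinite A
  rw [Nat.card_eq_fintype_card, Nat.card_eq_fintype_card]
  refine le_antisymm ?_ ?_
  · simpa using hli.fintype_card_le_finrank
  · let Ψ : (B → ℂ) →ₗ[ℂ] (A → ℂ) :=
      { toFun f a := ∑ g, f (cls g) * starRingEnd ℂ (χ a g)
        map_add' f f' := by
          ext a
          simp [add_mul, Finset.sum_add_distrib]
        map_smul' t f := by
          ext a
          simp [Finset.mul_sum, mul_assoc] }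
    have hΨ : Function.Injective Ψ := by
      rw [injective_iff_map_eq_zero]
      exact fun f hf => hcomplete f fun a => congrFun hf a
    simpa using LinearMap.finrank_le_finrank_of_injective hΨ

namespace OperatorFamily

open Module

variable {F J L ι : Type} [Field F] [AddCommGroup J] [Module F J] [Group L]
  (D : OperatorFamily F J L ι)

/-- Two pairs `(θ, l)` are related if they are conjugate under `L`, up to the orbit of `l`. -/
def relA (α α' : (L → ℂ) × Dual F J) : Prop :=
  ∃ r, D.Ad r α.2 ∈ D.orb α'.2 ∧ ∀ h, α'.1 h = α.1 (r⁻¹ * h * r)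

theorem relA_refl (α : (L → ℂ) × Dual F J) : D.relA α α :=
  ⟨1, by rw [Ad_one]; exact D.mem_orb_self _, fun h => by simp⟩

theorem relA_symm {α α' : (L → ℂ) × Dual F J} (h : D.relA α α') : D.relA α' α := by
  obtain ⟨r, h1, h2⟩ := h
  refine ⟨r⁻¹, (D.mem_orb_iff_of_Ad h1 _).mp (D.mem_orb_self _), fun x => ?_⟩
  rw [h2]
  group

theorem relA_trans {α α' α'' : (L → ℂ) × Dual F J} (h : D.relA α α') (h' : D.relA α' α'') :
    D.relA α α'' := by
  obtain ⟨r, h1, h2⟩ := h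
  obtain ⟨s, h3, h4⟩ := h'
  refine ⟨s * r, ?_, fun x => ?_⟩
  · rw [Ad_mul]
    exact (D.orb_Ad_eq h3 _).mpr h1
  · rw [h4, h2]
    group

/-- The preimage in `J` of the orbit of `x` modulo the common kernel attached to `h`. -/
def cell (h : L) (x : J) : Set J := {y | ∃ i, y - D.T i x ∈ D.fixedKernel h}

theorem add_mem_fixedKernel {h : L} {x y : J} (hx : x ∈ D.fixedKernel h)
    (hy : y ∈ D.fixedKernel h) : x + y ∈ D.fixedKernel h := fun μ hμ => by
  rw [map_add, hx μ hμ, hy μ hμ, add_zero]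

theorem T_mem_fixedKernel {h : L} {x : J} (hx : x ∈ D.fixedKernel h) (i : ι) :
    D.T i x ∈ D.fixedKernel h := fun μ hμ =>
  hx (μ ∘ₗ D.T i) (by rw [D.fixer_eq_of_mem ⟨i, rfl⟩]; exact hμ)

theorem mem_cell_self (h : L) (x : J) : x ∈ D.cell h x := by
  obtain ⟨i, hi⟩ := D.exists_one
  exact ⟨i, by rw [hi, Module.End.one_apply, sub_self]; exact D.zero_mem_fixedKernel h⟩

theorem cell_subset_of_mem {h : L} {x y : J} (hy : y ∈ D.cell h x) : D.cell h y ⊆ D.cell h x := by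
  rintro z ⟨j, hj⟩
  obtain ⟨i, hi⟩ := hy
  obtain ⟨e, he⟩ := D.exists_mul_left j
  refine ⟨e i, ?_⟩
  rw [he, Module.End.mul_apply]
  have := D.add_mem_fixedKernel hj (D.T_mem_fixedKernel hi j)
  rwa [map_sub, sub_add_sub_cancel] at this

theorem mem_cell_symm {h : L} {x y : J} (hy : y ∈ D.cell h x) : x ∈ D.cell h y := by
  obtain ⟨i, hi⟩ := hy
  obtain ⟨i₀, h₀⟩ := D.exists_one
  obtain ⟨e, he⟩ := D.exists_mul_right i
  refine ⟨e.symm i₀, ?_⟩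
  have h1 := he (e.symm i₀)
  rw [Equiv.apply_symm_apply, h₀] at h1
  have h2 := D.smul_mem_fixedKernel (D.T_mem_fixedKernel hi (e.symm i₀)) (-1)
  rwa [map_sub, ← Module.End.mul_apply, ← h1, Module.End.one_apply, neg_smul, one_smul,
    neg_sub] at h2

theorem cell_eq_of_mem {h : L} {x y : J} (hy : y ∈ D.cell h x) : D.cell h y = D.cell h x :=
  (D.cell_subset_of_mem hy).antisymm (D.cell_subset_of_mem (D.mem_cell_symm hy))

theorem c_mem_cell {h : L} {x y : J} (hy : y ∈ D.cell h x) (r : L) :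
    D.c r y ∈ D.cell (r * h * r⁻¹) (D.c r x) := by
  obtain ⟨i, hi⟩ := hy
  obtain ⟨e, he⟩ := D.exists_conj r
  refine ⟨e i, ?_⟩
  have := D.c_mem_fixedKernel hi r
  rwa [map_sub, ← Module.End.mul_apply, ← he, Module.End.mul_apply] at this

theorem image_c_cell (h : L) (x : J) (r : L) :
    D.c r '' D.cell h x = D.cell (r * h * r⁻¹) (D.c r x) := by
  ext y
  constructor
  · rintro ⟨z, hz, rfl⟩
    exact D.c_mem_cell hz r
  · intro hy
    refine ⟨D.c r⁻¹ y, ?_, D.c_apply_inv_apply r y⟩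
    have := D.c_mem_cell hy r⁻¹
    rwa [c_inv_apply_apply, show r⁻¹ * (r * h * r⁻¹) * r⁻¹⁻¹ = h by group] at this

/-- Conjugacy of pairs `(h, ω)` under `L`. -/
def relB (β β' : L × Set J) : Prop := ∃ r, β'.1 = r * β.1 * r⁻¹ ∧ β'.2 = D.c r '' β.2

theorem relB_refl (β : L × Set J) : D.relB β β :=
  ⟨1, by simp, by simp⟩

theorem relB_symm {β β' : L × Set J} (h : D.relB β β') : D.relB β' β := by
  obtain ⟨r, h1, h2⟩ := h
  refine ⟨r⁻¹, by rw [h1]; group, ?_⟩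
  rw [h2, Set.image_image]
  simp

theorem relB_trans {β β' β'' : L × Set J} (h : D.relB β β') (h' : D.relB β' β'') :
    D.relB β β'' := by
  obtain ⟨r, h1, h2⟩ := h
  obtain ⟨s, h3, h4⟩ := h'
  refine ⟨s * r, by rw [h3, h1]; group, ?_⟩
  rw [h4, h2, Set.image_image]
  simp

/-- The index set of pairs `(h, ω)`. -/
def idxB : Set (L × Set J) := {β | ∃ x, β.2 = D.cell β.1 x}

theorem mk_cell_mem_idxB (h : L) (x : J) : (h, D.cell h x) ∈ D.idxB := ⟨x, rfl⟩

/-- The `L`-orbit of `β`. -/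
def classB (β : L × Set J) : Set (L × Set J) := {β' ∈ D.idxB | D.relB β β'}

theorem classB_eq_iff {β β' : L × Set J} (hβ' : β' ∈ D.idxB) :
    D.classB β = D.classB β' ↔ D.relB β β' := by
  constructor
  · intro h
    have : β' ∈ D.classB β' := ⟨hβ', D.relB_refl β'⟩
    rw [← h] at this
    exact this.2
  · intro h
    ext γ
    exact and_congr_right fun _ => ⟨D.relB_trans (D.relB_symm h), D.relB_trans h⟩

theorem superSum_eq_of_relB [Fintype ι] [Fintype L] (ε : AddChar F ℂ) {θ : L → ℂ} {l : Dual F J}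
    (hθ : ∀ x ∉ D.fixer l, θ x = 0) {h h' : L} {x x' : J}
    (hr : D.relB (h, D.cell h x) (h', D.cell h' x')) :
    D.superSum ε θ l h x = D.superSum ε θ l h' x' := by
  obtain ⟨r, h1, h2⟩ := hr
  simp only at h1 h2
  have h3 : x' ∈ D.c r '' D.cell h x := by
    rw [← h2]
    exact D.mem_cell_self h' x'
  obtain ⟨y, ⟨i, hi⟩, rfl⟩ := h3
  rw [h1, superSum_conj]
  have := D.superSum_add_fixedKernel ε hθ h i x hi
  rw [add_sub_cancel] at this
  exact this.symm

end OperatorFamily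

namespace AlgebraGroupExtension

open Module

variable {F J L G : Type} [Field F] [NonUnitalRing J] [Module F J]
  [Group L] [Group G] (E : AlgebraGroupExtension F J L G)
  [SMulCommClass F J J] [IsScalarTower F J J] [Finite J] [Finite L]

/-- The union of the `L`-conjugates of `h (1 + ω)`, for `β = (h, ω)`. -/
def superclass (β : L × Set J) : Set G :=
  {g | ∃ p : L, ∃ x ∈ β.2, g = E.ρ p * (E.ρ β.1 * E.em x) * (E.ρ p)⁻¹}

theorem mem_superclass_iff {β : L × Set J} (hβ : β ∈ E.opFamily.idxB) (h : L) (x : J) :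
    E.ρ h * E.em x ∈ E.superclass β ↔ E.opFamily.relB β (h, E.opFamily.cell h x) := by
  constructor
  · rintro ⟨p, y, hy, he⟩
    obtain ⟨x₀, hx₀⟩ := hβ
    rw [rho_conj] at he
    have h1 := Prod.ext_iff.mp (E.bijective.1 (a₁ := (h, x)) (a₂ := (_, _)) he)
    simp only at h1
    obtain ⟨rfl, rfl⟩ := h1
    refine ⟨p, rfl, ?_⟩
    rw [hx₀] at hy ⊢
    rw [← E.opFamily.cell_eq_of_mem hy, E.opFamily.image_c_cell]
    rfl
  · rintro ⟨r, h1, h2⟩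
    have h3 : x ∈ E.opFamily.c r '' β.2 := by
      rw [← h2]
      exact E.opFamily.mem_cell_self h x
    obtain ⟨y, hy, rfl⟩ := h3
    refine ⟨r, y, hy, ?_⟩
    rw [rho_conj, ← show h = r * β.1 * r⁻¹ from h1]
    rfl

/-- The set of `L`-orbits of pairs `(h, ω)`. -/
def classesB : Set (Set (L × Set J)) :=
  {S | ∃ β ∈ E.opFamily.idxB, S = E.opFamily.classB β}

/-- The class containing the pair attached to `g`. -/
noncomputable def cls (g : G) : E.classesB :=
  ⟨E.opFamily.classB ((E.dec g).1, E.opFamily.cell (E.dec g).1 (E.dec g).2),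
    _, E.opFamily.mk_cell_mem_idxB _ _, rfl⟩

theorem cls_mul (h : L) (x : J) :
    (E.cls (E.ρ h * E.em x) : Set (L × Set J)) =
      E.opFamily.classB (h, E.opFamily.cell h x) := by
  change E.opFamily.classB (_, E.opFamily.cell _ _) = _
  rw [dec_mul]

theorem cls_surjective : Function.Surjective E.cls := by
  rintro ⟨_, ⟨h, ω⟩, ⟨x, hx⟩, rfl⟩
  obtain rfl : ω = E.opFamily.cell h x := hx
  exact ⟨_, Subtype.ext (E.cls_mul h x)⟩

theorem existsUnique_class (g : G) : ∃! S, S ∈ E.classesB ∧ ∃ β ∈ S, g ∈ E.superclass β := by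
  obtain ⟨⟨h, x⟩, rfl⟩ := E.bijective.2 g
  have hmem := E.opFamily.mk_cell_mem_idxB h x
  refine ⟨E.opFamily.classB (h, E.opFamily.cell h x), ⟨⟨_, hmem, rfl⟩, _,
    ⟨hmem, E.opFamily.relB_refl _⟩, (E.mem_superclass_iff hmem h x).mpr
      (E.opFamily.relB_refl _)⟩, ?_⟩
  rintro _ ⟨⟨β, hβ, rfl⟩, γ, ⟨hγ, hβγ⟩, hg⟩
  exact (E.opFamily.classB_eq_iff hmem).mpr
    (E.opFamily.relB_trans hβγ ((E.mem_superclass_iff hγ h x).mp hg))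

theorem superclass_one : ∃ β ∈ E.opFamily.idxB, E.superclass β = {1} := by
  have hcell : E.opFamily.cell 1 0 = {0} := by
    ext y
    constructor
    · rintro ⟨i, hi⟩
      rw [map_zero, sub_zero] at hi
      exact (Module.forall_dual_apply_eq_zero_iff F y).mp fun μ => hi μ (one_mem _)
    · rintro rfl
      exact E.opFamily.mem_cell_self 1 0
  refine ⟨_, E.opFamily.mk_cell_mem_idxB 1 0, ?_⟩
  ext g
  constructor
  · rintro ⟨p, x, hx, rfl⟩
    rw [hcell] at hx
    obtain rfl : x = 0 := hx
    simp [em_zero]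
  · rintro rfl
    exact ⟨1, 0, E.opFamily.mem_cell_self 1 0, by simp [em_zero]⟩

variable [Fintype J] [Fintype L] [Fintype G] [Finite F] {ε : AddChar F ℂ} (hε : ε ≠ 1)

/-- The index set of pairs `(θ, l)`, with `l` in the set `R`. -/
def idxA (R : Set (Dual F J)) : Set ((L → ℂ) × Dual F J) :=
  {α | α.2 ∈ R ∧
    IsOrbitIrrOn (E.opFamily.fixer α.2 : Set L) (E.opFamily.stab α.2) α.1}

include hε

theorem chi_eq_of_cls_eq {θ : L → ℂ} {l : Dual F J} (hθ : ∀ x ∉ E.opFamily.fixer l, θ x = 0)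
    {g g' : G} (h : E.cls g = E.cls g') :
    E.chi ε (E.opFamily.fixer l) θ l g = E.chi ε (E.opFamily.fixer l) θ l g' := by
  obtain ⟨⟨h, x⟩, rfl⟩ := E.bijective.2 g
  obtain ⟨⟨h', x'⟩, rfl⟩ := E.bijective.2 g'
  have h1 := congrArg Subtype.val h
  simp only [cls_mul] at h1
  rw [E.opFamily.classB_eq_iff (E.opFamily.mk_cell_mem_idxB _ _)] at h1
  simp only [E.chi_eq hε hθ]
  rw [E.opFamily.superSum_eq_of_relB ε hθ h1]

theorem chi_eq_of_mem_superclass {θ : L → ℂ} {l : Dual F J}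
    (hθ : ∀ x ∉ E.opFamily.fixer l, θ x = 0) {β : L × Set J} (hβ : β ∈ E.opFamily.idxB)
    {g g' : G} (hg : g ∈ E.superclass β) (hg' : g' ∈ E.superclass β) :
    E.chi ε (E.opFamily.fixer l) θ l g = E.chi ε (E.opFamily.fixer l) θ l g' := by
  refine E.chi_eq_of_cls_eq hε hθ (Subtype.ext ?_)
  obtain ⟨⟨h, x⟩, rfl⟩ := E.bijective.2 g
  obtain ⟨⟨h', x'⟩, rfl⟩ := E.bijective.2 g'
  simp only [cls_mul]
  rw [E.opFamily.classB_eq_iff (E.opFamily.mk_cell_mem_idxB _ _)]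
  exact E.opFamily.relB_trans (E.opFamily.relB_symm ((E.mem_superclass_iff hβ _ _).mp hg))
    ((E.mem_superclass_iff hβ _ _).mp hg')

theorem chi_eq_of_relA {θ θ' : L → ℂ} {l l' : Dual F J}
    (hθ : ∀ x ∉ E.opFamily.fixer l, θ x = 0) (hθ' : ∀ x ∉ E.opFamily.fixer l', θ' x = 0)
    (h : E.opFamily.relA (θ, l) (θ', l')) :
    E.chi ε (E.opFamily.fixer l) θ l = E.chi ε (E.opFamily.fixer l') θ' l' := by
  obtain ⟨r, h1, h2⟩ := h
  ext g
  obtain ⟨⟨h, x⟩, rfl⟩ := E.bijective.2 g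
  simp only [E.chi_eq hε hθ, E.chi_eq hε hθ']
  rw [E.opFamily.superSum_eq_of_Ad ε h1 h2, E.opFamily.card_fixer_eq_of_Ad h1,
    E.card_rad_eq_of_Ad h1]

theorem sum_mul_conj_chi {θ : L → ℂ} {l : Dual F J} (hθ : ∀ x ∉ E.opFamily.fixer l, θ x = 0)
    (f : G → ℂ) :
    ∑ g, f g * starRingEnd ℂ (E.chi ε (E.opFamily.fixer l) θ l g) =
      ((Nat.card (E.opFamily.fixer l) * Nat.card (rad l) * Nat.card J : ℕ) : ℂ)⁻¹ *
        ∑ h, ∑ x, f (E.ρ h * E.em x) * starRingEnd ℂ (E.opFamily.superSum ε θ l h x) := by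
  rw [← Function.Bijective.sum_comp E.bijective, Fintype.sum_prod_type, Finset.mul_sum]
  refine Finset.sum_congr rfl fun h _ => ?_
  rw [Finset.mul_sum]
  refine Finset.sum_congr rfl fun x _ => ?_
  rw [E.chi_eq hε hθ, map_mul, map_inv₀, map_natCast]
  ring

theorem chi_orthogonal {θ θ' : L → ℂ} {l l' : Dual F J}
    (hθ : IsOrbitIrrOn (E.opFamily.fixer l : Set L) (E.opFamily.stab l) θ)
    (hθ' : IsOrbitIrrOn (E.opFamily.fixer l' : Set L) (E.opFamily.stab l') θ')
    (h : ¬ E.opFamily.relA (θ, l) (θ', l')) :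
    ∑ g, E.chi ε (E.opFamily.fixer l) θ l g *
      starRingEnd ℂ (E.chi ε (E.opFamily.fixer l') θ' l' g) = 0 := by
  rw [E.sum_mul_conj_chi hε fun x hx => hθ'.eq_zero hx]
  simp only [E.chi_eq hε fun x hx => hθ.eq_zero hx, mul_assoc, ← Finset.mul_sum]
  rw [E.opFamily.superSum_orthogonal hε hθ hθ' fun r h1 h2 => h ⟨r, h1, h2⟩, mul_zero, mul_zero]

omit hε [Finite F] [Fintype L] [Fintype G] [Fintype J] in
theorem card_ne_zero (l : Dual F J) :
    ((Nat.card (E.opFamily.fixer l) * Nat.card (rad l) * Nat.card J : ℕ) : ℂ) ≠ 0 := by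
  have h1 : Nonempty (rad l) := ⟨⟨0, fun w => by rw [zero_mul, map_zero]⟩⟩
  have h2 : Nat.card (rad l) ≠ 0 := Nat.card_pos.ne'
  have h3 : Nat.card J ≠ 0 := Nat.card_pos.ne'
  have h4 : Nat.card (E.opFamily.fixer l) ≠ 0 := Nat.card_pos.ne'
  exact Nat.cast_ne_zero.mpr (mul_ne_zero (mul_ne_zero h4 h2) h3)

theorem chi_ne_zero {θ : L → ℂ} {l : Dual F J}
    (hθ : IsOrbitIrrOn (E.opFamily.fixer l : Set L) (E.opFamily.stab l) θ) :
    E.chi ε (E.opFamily.fixer l) θ l ≠ 0 := by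
  intro h0
  have h1 := congrFun h0 (E.ρ 1 * E.em 0)
  rw [E.chi_eq hε fun x hx => hθ.eq_zero hx, OperatorFamily.superSum_one_zero] at h1
  have : Nonempty J := ⟨0⟩
  exact mul_ne_zero (inv_ne_zero (E.card_ne_zero l)) (mul_ne_zero
    (Nat.cast_ne_zero.mpr Fintype.card_ne_zero) (mul_ne_zero hθ.apply_one_ne_zero
      (Nat.cast_ne_zero.mpr Fintype.card_ne_zero))) h1

theorem eq_zero_of_forall_chi {f : G → ℂ} (hf : ∀ g g', E.cls g = E.cls g' → f g = f g')
    (h0 : ∀ l θ, IsOrbitIrrOn (E.opFamily.fixer l : Set L) (E.opFamily.stab l) θ →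
      ∑ g, f g * starRingEnd ℂ (E.chi ε (E.opFamily.fixer l) θ l g) = 0) : f = 0 := by
  have hrel : ∀ h h' x x', E.opFamily.relB (h, E.opFamily.cell h x)
      (h', E.opFamily.cell h' x') → f (E.ρ h * E.em x) = f (E.ρ h' * E.em x') := by
    intro h h' x x' hr
    refine hf _ _ (Subtype.ext ?_)
    rw [cls_mul, cls_mul, E.opFamily.classB_eq_iff (E.opFamily.mk_cell_mem_idxB _ _)]
    exact hr
  have key : (fun h x => f (E.ρ h * E.em x)) = 0 := by
    refine E.opFamily.eq_zero_of_forall_superSum hε ?_ ?_ ?_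
    · intro h i x y hy
      refine hrel _ _ _ _ ⟨1, by simp, ?_⟩
      have : E.opFamily.T i x + y ∈ E.opFamily.cell h x := ⟨i, by rwa [add_sub_cancel_left]⟩
      rw [E.opFamily.cell_eq_of_mem this]
      simp
    · intro r h x
      refine (hrel _ _ _ _ ⟨r, rfl, ?_⟩).symm
      rw [E.opFamily.image_c_cell]
    · intro l θ hθ
      have h1 := h0 l θ hθ
      rw [E.sum_mul_conj_chi hε fun x hx => hθ.eq_zero hx] at h1
      exact (mul_eq_zero.mp h1).resolve_left (inv_ne_zero (E.card_ne_zero l))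
  ext g
  obtain ⟨⟨h, x⟩, rfl⟩ := E.bijective.2 g
  exact congrFun (congrFun key h) x

theorem card_classes {R : Set (Dual F J)} (hR : ∀ μ, ∃ l ∈ R, μ ∈ E.opFamily.orb l) :
    Nat.card {S | ∃ α ∈ E.idxA R, S = {α' ∈ E.idxA R | E.opFamily.relA α α'}} =
      Nat.card E.classesB := by
  let A := {S | ∃ α ∈ E.idxA R, S = {α' ∈ E.idxA R | E.opFamily.relA α α'}}
  choose a ha haS using fun S : A => S.2
  let X : A → G → ℂ := fun S => E.chi ε (E.opFamily.fixer (a S).2) (a S).1 (a S).2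
  refine card_eq_of_orthogonal_complete E.cls_surjective X
    (fun S b => X S (Function.surjInv E.cls_surjective b)) ?_ ?_ ?_ ?_
  · intro S g
    refine E.chi_eq_of_cls_eq hε (fun x hx => (ha S).2.eq_zero hx) ?_
    exact (Function.surjInv_eq E.cls_surjective (E.cls g)).symm
  · exact fun S => E.chi_ne_zero hε (ha S).2
  · intro S S' hne
    refine E.chi_orthogonal hε (ha S).2 (ha S').2 fun hr => hne (Subtype.ext ?_)
    rw [haS S, haS S']
    ext γ
    exact and_congr_right fun _ => ⟨E.opFamily.relA_trans (E.opFamily.relA_symm hr),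
      E.opFamily.relA_trans hr⟩
  · intro f hf
    have key : f ∘ E.cls = 0 := by
      refine E.eq_zero_of_forall_chi hε (fun g g' h => congrArg f h) fun l θ hθ => ?_
      obtain ⟨l₀, hl₀, hl⟩ := hR l
      rw [E.opFamily.fixer_eq_of_mem hl, E.opFamily.stab_eq_of_mem hl] at hθ
      have hmem : (θ, l₀) ∈ E.idxA R := ⟨hl₀, hθ⟩
      let S : A := ⟨_, _, hmem, rfl⟩
      have h1 : (θ, l₀) ∈ (S : Set ((L → ℂ) × Dual F J)) := ⟨hmem, E.opFamily.relA_refl _⟩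
      rw [haS S] at h1
      have h2 : E.opFamily.relA (a S) (θ, l) := E.opFamily.relA_trans h1.2
        (E.opFamily.relA_symm ⟨1, by rwa [OperatorFamily.Ad_one], fun x => by simp⟩)
      rw [← E.chi_eq_of_relA hε (fun x hx => (ha S).2.eq_zero hx) (fun x hx => hθ.eq_zero
        (by rwa [E.opFamily.fixer_eq_of_mem hl] at hx)) h2]
      exact hf S
    ext b
    obtain ⟨g, rfl⟩ := E.cls_surjective b
    exact congrFun key g

end AlgebraGroupExtension

theorem stmt_15
    (F : Type) [Field F] [Fintype F]
    (J : Type) [NonUnitalRing J] [Module F J]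
    [SMulCommClass F J J] [IsScalarTower F J J] [Fintype J]
    (hnil : ∃ N : ℕ, ∀ x : ℕ → J,
      (List.range N).foldr (fun i acc => x i * acc) (x N) = 0)
    (L : Type) [Group L] [Fintype L]
    (lact : L → J → J) (ract : J → L → J)
    (hlactlin : ∀ h : L, IsLinearMap F (lact h))
    (hractlin : ∀ h : L, IsLinearMap F (fun x => ract x h))
    (hlact_one : ∀ x : J, lact 1 x = x)
    (hlact_mul : ∀ h k : L, ∀ x : J, lact (h * k) x = lact h (lact k x))
    (hract_one : ∀ x : J, ract x 1 = x)
    (hract_mul : ∀ h k : L, ∀ x : J, ract x (h * k) = ract (ract x h) k)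
    (hcomm : ∀ h k : L, ∀ x : J, ract (lact h x) k = lact h (ract x k))
    (hlmul : ∀ h : L, ∀ x y : J, lact h (x * y) = lact h x * y)
    (hrmul : ∀ h : L, ∀ x y : J, ract (x * y) h = x * ract y h)
    (hmid : ∀ h : L, ∀ x y : J, x * lact h y = ract x h * y)
    (G : Type) [Group G] [Fintype G]
    (ρ : L →* G) (em : J → G)
    (hem : ∀ x y : J, em x * em y = em (x + y + x * y))
    (hsplit : Function.Bijective (fun p : L × J => ρ p.1 * em p.2))
    (hconj : ∀ (h : L) (x : J), ρ h * em x * (ρ h)⁻¹ = em (lact h (ract x h⁻¹)))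
    (ε : AddChar F ℂ) (hε : ε ≠ 1)
 :
    let dec : G → L × J :=
      @Function.invFun (L × J) G ⟨(1, 0)⟩ fun p : L × J => ρ p.1 * em p.2
    let Jrt : Module.Dual F J → Set J := fun l => {z : J | ∀ w : J, l (z * w) = 0}
    let Fix : L → Module.Dual F J → Prop := fun r μ =>
      ∀ x : J, μ (ract (lact r⁻¹ x) r) = μ x
    let IsIrrOn : Set L → (L → ℂ) → Prop := fun H ψ =>
      (∀ h : L, h ∉ H → ψ h = 0) ∧
      ∃ H₀ : Subgroup L, (H₀ : Set L) = H ∧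
        ∃ W : FDRep ℂ ↥H₀, CategoryTheory.Simple W ∧
          ∀ h : ↥H₀, ψ ↑h = W.character h
    let GlaU : Module.Dual F J → Set (Module.Dual F J) := fun l =>
      {μ | ∃ (k : L) (w z : J), ∀ x : J,
        μ x = l (ract (x + z * x) k + ract (x + z * x) k * w)}
    let Hset : Module.Dual F J → Set L := fun l => {r : L | ∀ μ ∈ GlaU l, Fix r μ}
    let Sset : Module.Dual F J → Set L := fun l =>
      {r : L | ∀ μ ν : Module.Dual F J,
        (∀ x : J, ν x = μ (ract (lact r⁻¹ x) r)) → (μ ∈ GlaU l ↔ ν ∈ GlaU l)}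
    let IsSIrr : Module.Dual F J → (L → ℂ) → Prop := fun l θ =>
      ∃ Sfin : Finset (L → ℂ),
        (∀ ψ ∈ Sfin, IsIrrOn (Hset l) ψ) ∧
        (∃ ψ₀ ∈ Sfin, ∀ ψ : L → ℂ,
          ψ ∈ Sfin ↔ ∃ r ∈ Sset l, ∀ h : L, ψ h = ψ₀ (r * h * r⁻¹)) ∧
        ∀ h : L, θ h = ∑ ψ ∈ Sfin, ψ h
    let ξdot : (L → ℂ) → Module.Dual F J → G → ℂ := fun θ l s =>
      if (dec s).1 ∈ Hset l ∧ (dec s).2 ∈ Jrt l then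
        ∑ p : L, θ (dec s).1 * ε (l (ract (dec s).2 p))
      else 0
    let χ : (L → ℂ) → Module.Dual F J → G → ℂ := fun θ l g =>
      ((Nat.card ↥(Hset l) * Nat.card ↥(Jrt l) : ℕ) : ℂ)⁻¹ *
        ∑ s : G, ξdot θ l (s * g * s⁻¹)
    let Rel : ((L → ℂ) × Module.Dual F J) → ((L → ℂ) × Module.Dual F J) → Prop :=
      fun α α' => ∃ r : L,
        (∀ ν : Module.Dual F J,
          (∀ x : J, ν x = α.2 (ract (lact r⁻¹ x) r)) → ν ∈ GlaU α'.2) ∧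
        ∀ h : L, α'.1 h = α.1 (r⁻¹ * h * r)
    let Jh : L → Set J := fun h =>
      {x : J | ∀ μ : Module.Dual F J,
        (∃ ν : Module.Dual F J, μ ∈ GlaU ν ∧ ∀ σ ∈ GlaU ν, Fix h σ) → μ x = 0}
    let orbUG : J → Set J := fun x₀ =>
      {y : J | ∃ (w : J) (k : L) (w' : J),
        y = ract (x₀ + w * x₀) k + ract (x₀ + w * x₀) k * w'}
    let K : L × Set J → Set G := fun β =>
      {g : G | ∃ p : L, ∃ x ∈ β.2, g = ρ p * (ρ β.1 * em x) * (ρ p)⁻¹}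
    let RelB : (L × Set J) → (L × Set J) → Prop := fun β β' =>
      ∃ r : L, β'.1 = r * β.1 * r⁻¹ ∧
        β'.2 = (fun x : J => lact r (ract x r⁻¹)) '' β.2
    ∀ R : Set (Module.Dual F J),
      (∀ μ : Module.Dual F J, ∃! l, l ∈ R ∧ μ ∈ GlaU l) →
    let A0 : Set ((L → ℂ) × Module.Dual F J) :=
      {α | α.2 ∈ R ∧ IsSIrr α.2 α.1}
    let B0 : Set (L × Set J) :=
      {β | ∃ x₀ : J, β.2 = {y : J | ∃ z ∈ orbUG x₀, y - z ∈ Jh β.1}}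
    let orbitsA : Set (Set ((L → ℂ) × Module.Dual F J)) :=
      {S | ∃ α ∈ A0, S = {α' ∈ A0 | Rel α α'}}
    let orbitsB : Set (Set (L × Set J)) :=
      {S | ∃ β ∈ B0, S = {β' ∈ B0 | RelB β β'}}
    (∀ α ∈ A0, ∃ W : FDRep ℂ G, ∀ g : G, χ α.1 α.2 g = W.character g) ∧
    (∀ α ∈ A0, ∀ α' ∈ A0,
      (Rel α α' → χ α.1 α.2 = χ α'.1 α'.2) ∧
      (¬ Rel α α' →
        (Fintype.card G : ℂ)⁻¹ *
          (∑ g : G, χ α.1 α.2 g * (starRingEnd ℂ) (χ α'.1 α'.2 g)) = 0)) ∧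
    (∀ g : G, ∃! S, S ∈ orbitsB ∧ ∃ β ∈ S, g ∈ K β) ∧
    (∃ β ∈ B0, K β = {1}) ∧
    (∀ α ∈ A0, ∀ β ∈ B0, ∀ g ∈ K β, ∀ g' ∈ K β, χ α.1 α.2 g = χ α.1 α.2 g') ∧
    Nat.card ↥orbitsA = Nat.card ↥orbitsB := by
  intro dec Jrt Fix IsIrrOn' GlaU Hset Sset IsSIrr ξdot χ Rel Jh orbUG K RelB R hR
    A0 B0 orbitsA orbitsB
  let E : AlgebraGroupExtension F J L G :=
    ⟨lact, ract, hlactlin, hractlin, hlact_one, hlact_mul, hract_one, hract_mul, hcomm, hlmul,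
      hrmul, hmid, ρ, em, hem, hsplit, hconj⟩
  have hAd : ∀ (r : L) (μ : Module.Dual F J) (x : J),
      E.opFamily.Ad r μ x = μ (ract (lact r⁻¹ x) r) := by
    intro r μ x
    change μ (ract (lact r⁻¹ x) r⁻¹⁻¹) = _
    rw [inv_inv]
  have hAd_iff : ∀ (r : L) (μ ν : Module.Dual F J),
      (∀ x, ν x = μ (ract (lact r⁻¹ x) r)) ↔ ν = E.opFamily.Ad r μ := fun r μ ν =>
    ⟨fun h => LinearMap.ext fun x => (h x).trans (hAd r μ x).symm, fun h x => h ▸ hAd r μ x⟩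
  have hFix : ∀ r μ, Fix r μ ↔ E.opFamily.Ad r μ = μ := fun r μ =>
    ⟨fun h => LinearMap.ext fun x => (hAd r μ x).trans (h x),
      fun h x => (hAd r μ x).symm.trans (LinearMap.congr_fun h x)⟩
  have hG : ∀ l, GlaU l = E.opFamily.orb l := by
    intro l
    ext μ
    exact ⟨fun ⟨k, w, z, h⟩ => ⟨(z, k, w), LinearMap.ext h⟩,
      fun ⟨⟨z, k, w⟩, h⟩ => ⟨k, w, z, LinearMap.congr_fun h⟩⟩
  have hH : ∀ l, Hset l = E.opFamily.fixer l := by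
    intro l
    ext r
    change (∀ μ ∈ GlaU l, Fix r μ) ↔ ∀ μ ∈ E.opFamily.orb l, E.opFamily.Ad r μ = μ
    simp only [hG, hFix]
  have hS : ∀ l, Sset l = E.opFamily.stab l := by
    intro l
    ext r
    change (∀ μ ν, (∀ x, ν x = μ (ract (lact r⁻¹ x) r)) → (μ ∈ GlaU l ↔ ν ∈ GlaU l)) ↔
      ∀ μ, μ ∈ E.opFamily.orb l ↔ E.opFamily.Ad r μ ∈ E.opFamily.orb l
    simp only [hG, hAd_iff, forall_eq]
  have hA0 : A0 = E.idxA R := by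
    ext α
    change (_ ∧ IsOrbitIrrOn (Hset α.2) (Sset α.2) α.1) ↔ _
    rw [hH, hS]
    rfl
  have hχ : ∀ θ l, χ θ l = E.chi ε (E.opFamily.fixer l) θ l := by
    intro θ l
    rw [← hH]
    have hξ : ξdot θ l = E.xi ε (Hset l) θ l := by
      funext s
      dsimp only [ξdot, AlgebraGroupExtension.xi]
      exact ite_congr rfl (fun _ => rfl) fun _ => rfl
    funext g
    dsimp only [χ, AlgebraGroupExtension.chi]
    rw [hξ]
    rfl
  have hRel : ∀ α α', Rel α α' ↔ E.opFamily.relA α α' := by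
    intro α α'
    refine exists_congr fun r => and_congr_left fun _ => ?_
    simp only [hG, hAd_iff, forall_eq]
  have hJh : ∀ h, Jh h = E.opFamily.fixedKernel h := by
    intro h
    ext x
    refine forall_congr' fun μ => imp_congr_left ?_
    simp only [hG, hFix]
    constructor
    · rintro ⟨ν, hμ, hν⟩
      rw [E.opFamily.fixer_eq_of_mem hμ]
      exact hν
    · exact fun hμ => ⟨μ, E.opFamily.mem_orb_self μ, hμ⟩
  have hB0 : B0 = E.opFamily.idxB := by
    ext β
    refine exists_congr fun x => Eq.congr_right ?_
    ext y
    constructor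
    · rintro ⟨_, ⟨z, k, w, rfl⟩, hy⟩
      rw [hJh] at hy
      exact ⟨(z, k, w), hy⟩
    · rintro ⟨⟨z, k, w⟩, hy⟩
      rw [← hJh] at hy
      exact ⟨_, ⟨z, k, w, rfl⟩, hy⟩
  have hRelB : ∀ β β', RelB β β' ↔ E.opFamily.relB β β' := by
    intro β β'
    refine exists_congr fun r => and_congr_right fun _ => ?_
    rw [show (fun x : J => lact r (ract x r⁻¹)) = E.opFamily.c r from
      funext fun x => (E.c_apply' r x).symm]
  have hoA : orbitsA = {S | ∃ α ∈ E.idxA R, S = {α' ∈ E.idxA R | E.opFamily.relA α α'}} := by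
    simp only [orbitsA, hA0, hRel]
  have hoB : orbitsB = E.classesB := by
    simp only [orbitsB, hB0, hRelB]
    rfl
  rw [hoA, hoB, hA0, hB0]
  simp only [hχ, hRel]
  refine ⟨fun α hα => E.isCharacter_chi ε hα.2, fun α hα α' hα' => ⟨fun h => ?_, fun h => ?_⟩,
    E.existsUnique_class, E.superclass_one, fun α hα β hβ g hg g' hg' => ?_, ?_⟩
  · exact E.chi_eq_of_relA hε (fun x hx => hα.2.eq_zero hx) (fun x hx => hα'.2.eq_zero hx) h
  · rw [E.chi_orthogonal hε hα.2 hα'.2 h, mul_zero]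
  · exact E.chi_eq_of_mem_superclass hε (fun x hx => hα.2.eq_zero hx) hβ hg hg'
  · refine E.card_classes hε fun μ => ?_
    obtain ⟨l, ⟨hl, hμ⟩, -⟩ := hR μ
    exact ⟨l, hl, hG l ▸ hμ⟩
end
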